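/- Let Ω be a finite set and let G be a solvable subgroup of the symmetric group on Ω acting primitively on Ω. If |Ω| = 16 or |Ω| = 27, then (G, Ω) is nice: there exist subsets Δ₁, Δ₂ of Ω with |Δ₁| < |Δ₂| and 2|Δ₂| ≤ |Ω| such that for j = 1, 2, the setwise stabilizer of Δ_j in G has a normal elementary abelian 3-subgroup (possibly trivial) with 2-group quotient. -/

import Mathlib

open Pointwise

/-- A finite group `S` has the "required structure" if it has a (possibly trivial) normal
elementary abelian 3-subgroup `N` such that the quotient `S/N` is a 2-group. -/
def RequiredStructure (S : Type*) [Group S] : Prop :=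
  ∃ (N : Subgroup S) (hN : N.Normal),
    (∀ x ∈ N, ∀ y ∈ N, x * y = y * x) ∧ (∀ x ∈ N, x ^ 3 = 1) ∧
    @IsPGroup 2 (S ⧸ N) (@QuotientGroup.Quotient.group S _ N hN)

/-- A finite permutation group `(G, Ω)` is "nice" if there are subsets `Δ₁, Δ₂` of `Ω`
with `|Δ₁| < |Δ₂| ≤ |Ω|/2` whose setwise stabilizers in `G` both have the required
structure. -/
def IsNice (Ω : Type*) [Fintype Ω] (G : Subgroup (Equiv.Perm Ω)) : Prop :=
  ∃ Δ₁ Δ₂ : Set Ω, Δ₁.ncard < Δ₂.ncard ∧ 2 * Δ₂.ncard ≤ Fintype.card Ω ∧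
    RequiredStructure (MulAction.stabilizer G Δ₁) ∧
    RequiredStructure (MulAction.stabilizer G Δ₂)

/-- A permutation group `(G, Ω)` is primitive if it is transitive and every block is trivial. -/
def IsPrimitivePermGroup (Ω : Type*) [Fintype Ω] (G : Subgroup (Equiv.Perm Ω)) : Prop :=
  MulAction.IsPretransitive G Ω ∧
    ∀ B : Set Ω, MulAction.IsBlock G B → MulAction.IsTrivialBlock B

theorem requiredStructure_of_pow_eq_one {S : Type*} [Group S]
    (hcomm : ∀ x y : S, x ^ 3 = 1 → y ^ 3 = 1 → Commute x y)
    (hpow : ∀ x : S, ∃ k : ℕ, x ^ (2 ^ k * 3) = 1) : RequiredStructure S := by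
  let N : Subgroup S :=
    { carrier := {x | x ^ 3 = 1}
      mul_mem' := fun {x y} hx hy => by
        rw [Set.mem_ofPred_eq, (hcomm x y hx hy).mul_pow, hx, hy, one_mul]
      one_mem' := one_pow 3
      inv_mem' := fun {x} hx => by rw [Set.mem_ofPred_eq, inv_pow, hx, inv_one] }
  have hN : N.Normal := ⟨fun x hx g => by
    change (g * x * g⁻¹) ^ 3 = 1
    rw [conj_pow, show x ^ 3 = 1 from hx, mul_one, mul_inv_cancel]⟩
  refine ⟨N, hN, fun x hx y hy => hcomm x y hx hy, fun x hx => hx, fun g => ?_⟩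
  obtain ⟨x, rfl⟩ := QuotientGroup.mk_surjective g
  obtain ⟨k, hk⟩ := hpow x
  refine ⟨k, ?_⟩
  rw [← QuotientGroup.mk_pow, QuotientGroup.eq_one_iff]
  change (x ^ 2 ^ k) ^ 3 = 1
  rw [← pow_mul, hk]

open Subgroup in
/-- In a finite solvable group, a normal subgroup that does not contain its centralizer has a
normal subgroup of prime power order that centralizes it without lying inside it. -/
theorem exists_normal_isPGroup_le_centralizer {H : Type*} [Group H] [Finite H] [Group.IsSolvable H]
    (A : Subgroup H) [A.Normal] (hA : ¬ centralizer (A : Set H) ≤ A) :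
    ∃ (p : ℕ) (P : Subgroup H), p.Prime ∧ P.Normal ∧ IsPGroup p P ∧ ¬ P ≤ A ∧
      P ≤ centralizer (A : Set H) ∧ ⁅P, P⁆ ≤ A := by
  set C := centralizer (A : Set H) with hC
  let D : ℕ → Subgroup H := fun n => (derivedSeries C n).map C.subtype
  have hDn : ∀ n, (D n).Normal := fun n => inferInstance
  have hDC : ∀ n, D n ≤ C := fun n => map_subtype_le _
  have hDs : ∀ n, D (n + 1) = ⁅D n, D n⁆ := fun n => by
    simp only [D, derivedSeries_succ, map_commutator]
  have hex : ∃ n, D n ≤ A := by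
    obtain ⟨n, hn⟩ := (inferInstance : Group.IsSolvable C).solvable
    exact ⟨n, by simp [D, hn]⟩
  classical
  obtain ⟨n, hn⟩ : ∃ n, Nat.find hex = n + 1 := by
    refine Nat.exists_eq_succ_of_ne_zero fun h0 => hA ?_
    have := Nat.find_spec hex
    rw [h0] at this
    simpa [D, ← MonoidHom.range_eq_map] using this
  have hB1 : ¬ D n ≤ A := Nat.find_min hex (by omega)
  have hB2 : ⁅D n, D n⁆ ≤ A := by
    rw [← hDs, ← hn]; exact Nat.find_spec hex
  set B := D n with hB
  have hBC : B ≤ C := hDC n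
  have : Group.IsNilpotent B := by
    have hcomm : ∀ a b : B ⧸ A.subgroupOf B, a * b = b * a := by
      intro a b
      induction a using QuotientGroup.induction_on with | H a => ?_
      induction b using QuotientGroup.induction_on with | H b => ?_
      rw [← QuotientGroup.mk_mul, ← QuotientGroup.mk_mul, QuotientGroup.eq, mem_subgroupOf]
      have := hB2 (commutator_mem_commutator (inv_mem b.2) (inv_mem a.2))
      simpa [commutatorElement_def, mul_assoc] using this
    let _ : CommGroup (B ⧸ A.subgroupOf B) := { mul_comm := hcomm }
    refine Subgroup.isNilpotent_of_ker_le_center (QuotientGroup.mk' (A.subgroupOf B)) ?_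
    rw [QuotientGroup.ker_mk']
    intro a ha
    rw [mem_center_iff]
    intro b
    exact Subtype.ext ((mem_centralizer_iff.mp (hBC b.2) a ha).symm)
  have hK : (A.subgroupOf B).index ≠ 1 := by
    rw [Ne, index_eq_one, subgroupOf_eq_top]; exact hB1
  obtain ⟨p, hp, hpd⟩ := Nat.exists_prime_and_dvd hK
  have : Fact p.Prime := ⟨hp⟩
  obtain ⟨P⟩ : Nonempty (Sylow p B) := inferInstance
  have hPn : (P : Subgroup B).Normal := inferInstance
  have hPc : (P : Subgroup B).Characteristic := P.characteristic_of_normal hPn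
  have hle : (P : Subgroup B).map B.subtype ≤ B := map_subtype_le _
  refine ⟨p, (P : Subgroup B).map B.subtype, hp, inferInstance, P.2.map _, fun h => ?_,
    hle.trans hBC, (commutator_mono hle hle).trans hB2⟩
  have h' : (P : Subgroup B) ≤ A.subgroupOf B := map_le_iff_le_comap.mp h
  exact P.not_dvd_index (hpd.trans (index_dvd_of_le h'))

/-- Conjugation on a normal subgroup of prime order `q` factors through a cyclic group of units. -/
theorem Subgroup.exists_conj_hom_of_card_eq_prime {H : Type*} [Group H] (P : Subgroup H) [P.Normal]
    {q : ℕ} (hq : q.Prime) (hcard : Nat.card P = q) :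
    ∃ f : H →* (ZMod q)ˣ, ∀ y : H, f y = 1 → ∀ g ∈ P, Commute g y := by
  subst hcard
  have : Fact (Nat.card P).Prime := ⟨hq⟩
  have hcyc : IsCyclic P := isCyclic_of_prime_card rfl
  refine ⟨(IsCyclic.mulAutMulEquiv P).toMonoidHom.comp (MulAut.conjNormal (H := P)),
    fun y hy g hg => ?_⟩
  have h1 : (MulAut.conjNormal (H := P) y) = 1 := by
    apply (IsCyclic.mulAutMulEquiv P).injective
    rw [map_one]; exact hy
  have h2 := congrArg Subtype.val (DFunLike.congr_fun h1 ⟨g, hg⟩)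
  rw [MulAut.conjNormal_apply, MulAut.one_apply] at h2
  exact (mul_inv_eq_iff_eq_mul.mp h2).symm

theorem Subgroup.commute_pow_sub_one_of_card_eq_prime {H : Type*} [Group H] (P : Subgroup H)
    [P.Normal] {q : ℕ} (hq : q.Prime) (hcard : Nat.card P = q) (h : H) :
    ∀ g ∈ P, Commute g (h ^ (q - 1)) := by
  obtain ⟨f, hf⟩ := P.exists_conj_hom_of_card_eq_prime hq hcard
  refine hf _ ?_
  rw [map_pow, ← Nat.totient_prime hq]
  exact ZMod.pow_totient (f h)

theorem Subgroup.commute_commutator_of_card_eq_prime {H : Type*} [Group H] (P : Subgroup H)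
    [P.Normal] {q : ℕ} (hq : q.Prime) (hcard : Nat.card P = q) (h k : H) :
    ∀ g ∈ P, Commute g (h * k * (k * h)⁻¹) := by
  obtain ⟨f, hf⟩ := P.exists_conj_hom_of_card_eq_prime hq hcard
  refine hf _ ?_
  rw [map_mul, map_inv, map_mul, map_mul, mul_comm (f k), mul_inv_cancel]

theorem IsPGroup.ncard_modEq_ncard_fixed {G X : Type*} [Group G] [MulAction G X] [Finite X]
    {p : ℕ} [Fact p.Prime] {P : Subgroup G} (hP : IsPGroup p P) (s : Set X)
    (hs : ∀ g ∈ P, ∀ x ∈ s, g • x ∈ s) :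
    s.ncard ≡ {x ∈ s | ∀ g ∈ P, g • x = x}.ncard [MOD p] := by
  let _ : MulAction P s :=
    { smul := fun g x => ⟨(g : G) • (x : X), hs g g.2 x x.2⟩
      one_smul := fun x => Subtype.ext (one_smul G (x : X))
      mul_smul := fun g h x => Subtype.ext (mul_smul (g : G) (h : G) (x : X)) }
  have key := hP.card_modEq_card_fixedPoints s
  rw [Nat.card_coe_set_eq] at key
  have hfix : Nat.card (MulAction.fixedPoints P s) = {x ∈ s | ∀ g ∈ P, g • x = x}.ncard := by
    rw [← Nat.card_coe_set_eq]
    exact Nat.card_congr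
      { toFun := fun x => ⟨x.1.1, x.1.2, fun g hg => congrArg Subtype.val (x.2 ⟨g, hg⟩)⟩
        invFun := fun x => ⟨⟨x.1, x.2.1⟩, fun g => Subtype.ext (x.2.2 g g.2)⟩
        left_inv := fun _ => rfl
        right_inv := fun _ => rfl }
  rwa [hfix] at key

/-- No proper nontrivial additive subgroup of `V` is stable under the action of `H`. -/
def IsIrreducibleAction (H V : Type*) [Group H] [AddCommGroup V] [DistribMulAction H V] : Prop :=
  ∀ W : AddSubgroup V, (∀ h : H, ∀ w ∈ W, h • w ∈ W) → W = ⊥ ∨ W = ⊤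

section Action

variable {H V : Type*} [Group H] [AddCommGroup V] [DistribMulAction H V]

/-- The additive subgroup of vectors fixed by all elements of `P`. -/
def fixedAddSubgroup (V : Type*) [AddCommGroup V] [DistribMulAction H V] (P : Subgroup H) :
    AddSubgroup V where
  carrier := {v | ∀ g ∈ P, g • v = v}
  add_mem' := fun {v w} hv hw g hg => by rw [smul_add, hv g hg, hw g hg]
  zero_mem' := fun g _ => smul_zero g
  neg_mem' := fun {v} hv g hg => by rw [smul_neg, hv g hg]

theorem IsIrreducibleAction.eq_zero_of_fixed [FaithfulSMul H V] (hirr : IsIrreducibleAction H V)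
    {P : Subgroup H} [hn : P.Normal] (hP : P ≠ ⊥) {v : V} (hv : ∀ g ∈ P, g • v = v) : v = 0 := by
  have hmem : v ∈ fixedAddSubgroup V P := hv
  rcases hirr (fixedAddSubgroup V P) fun h w hw g hg => by
    have := hw (h⁻¹ * g * h) (by simpa using hn.conj_mem g hg h⁻¹)
    rw [mul_smul, mul_smul, inv_smul_eq_iff] at this
    exact this with h | h
  · simpa [h] using hmem
  · refine absurd ((Subgroup.eq_bot_iff_forall P).mpr fun g hg => ?_) hP
    refine FaithfulSMul.eq_of_smul_eq_smul (α := V) fun w => ?_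
    have hw : w ∈ fixedAddSubgroup V P := h ▸ AddSubgroup.mem_top w
    rw [hw g hg, one_smul]

theorem card_modEq_card_fixedAddSubgroup [Finite V] {p : ℕ} [Fact p.Prime] {P : Subgroup H}
    (hP : IsPGroup p P) : Nat.card V ≡ Nat.card (fixedAddSubgroup V P) [MOD p] := by
  have := hP.ncard_modEq_ncard_fixed (Set.univ : Set V) fun _ _ _ _ => Set.mem_univ _
  rw [Set.ncard_univ] at this
  simp only [Set.mem_univ, true_and] at this
  exact this

theorem card_modEq_one_of_fixed_eq_zero [Finite V] {p : ℕ} [Fact p.Prime] {P : Subgroup H}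
    (hP : IsPGroup p P) (hfix : ∀ v : V, (∀ g ∈ P, g • v = v) → v = 0) (W : AddSubgroup V)
    (hW : ∀ g ∈ P, ∀ w ∈ W, g • w ∈ W) : Nat.card W ≡ 1 [MOD p] := by
  have := hP.ncard_modEq_ncard_fixed (W : Set V) hW
  have h0 : {x ∈ (W : Set V) | ∀ g ∈ P, g • x = x} = {0} := by
    ext x
    exact ⟨fun h => hfix x h.2, fun h => by
      rw [Set.mem_singleton_iff.mp h]; exact ⟨W.zero_mem, fun g _ => smul_zero g⟩⟩
  rwa [h0, Set.ncard_singleton] at this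

/-- A normal `q`-subgroup acting with `q` so large that `V` has no proper nontrivial subgroups of
order `1` modulo `q`. -/
theorem IsIrreducibleAction.stabilizer_of_normal_qGroup [Finite V] [FaithfulSMul H V]
    (hirr : IsIrreducibleAction H V) {q : ℕ} [hq : Fact q.Prime] {P : Subgroup H} [hn : P.Normal]
    (hP : IsPGroup q P) (hbot : P ≠ ⊥) (hlt : Nat.card V < q ^ 2)
    (hW : ∀ W : AddSubgroup V, Nat.card W ≡ 1 [MOD q] → W = ⊥ ∨ W = ⊤) :
    (∀ g ∈ P, ∀ v : V, v ≠ 0 → g • v = v → g = 1) ∧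
    (∀ y : H, (∀ g ∈ P, Commute g y) → ∀ v : V, v ≠ 0 → y • v = v → y = 1) ∧
    (∀ h : H, ∀ g ∈ P, Commute g (h ^ (q - 1))) ∧
    (∀ h k : H, ∀ v : V, v ≠ 0 → h • v = v → k • v = v → Commute h k) := by
  have hfix : ∀ v : V, (∀ g ∈ P, g • v = v) → v = 0 := fun v => hirr.eq_zero_of_fixed hbot
  have hcent : ∀ y : H, (∀ g ∈ P, Commute g y) → ∀ v : V, v ≠ 0 → y • v = v → y = 1 := by
    intro y hy v hv hyv
    let W : AddSubgroup V := fixedAddSubgroup V (Subgroup.zpowers y)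
    have memW : ∀ w, w ∈ W ↔ y • w = w := fun w =>
      ⟨fun h => h y (Subgroup.mem_zpowers y), fun h => by
        have : Subgroup.zpowers y ≤ MulAction.stabilizer H w := by
          rw [Subgroup.zpowers_le]; exact h
        exact fun g hg => this hg⟩
    have := card_modEq_one_of_fixed_eq_zero hP hfix W fun g hg w hw => by
      rw [memW] at hw ⊢
      rw [← mul_smul, ← (hy g hg).eq, mul_smul, hw]
    rcases hW W this with h | h
    · have : v ∈ W := (memW v).mpr hyv
      rw [h] at this
      exact absurd this hv
    · refine FaithfulSMul.eq_of_smul_eq_smul (α := V) fun w => ?_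
      rw [(memW w).mp (h ▸ AddSubgroup.mem_top w), one_smul]
  have hV1 : Nat.card V ≡ 1 [MOD q] := by
    simpa using card_modEq_one_of_fixed_eq_zero hP hfix ⊤ fun _ _ _ _ => AddSubgroup.mem_top _
  have hfree : ∀ g ∈ P, ∀ v : V, v ≠ 0 → g • v = v → g = 1 := by
    intro g hg v hv hgv
    have hz : Subgroup.zpowers g ≤ P := by rwa [Subgroup.zpowers_le]
    have hc := card_modEq_card_fixedAddSubgroup (V := V) (hP.to_le hz)
    have hst : v ∈ fixedAddSubgroup V (Subgroup.zpowers g) := by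
      have : Subgroup.zpowers g ≤ MulAction.stabilizer H v := by
        rw [Subgroup.zpowers_le]; exact hgv
      exact fun x hx => this hx
    rcases hW _ (hc.symm.trans hV1) with h | h
    · rw [h] at hst
      exact absurd hst hv
    · refine FaithfulSMul.eq_of_smul_eq_smul (α := V) fun w => ?_
      have : w ∈ fixedAddSubgroup V (Subgroup.zpowers g) := h ▸ AddSubgroup.mem_top w
      rw [this g (Subgroup.mem_zpowers g), one_smul]
  have hcardP : Nat.card P = q := by
    have hne : ∃ v : V, v ≠ 0 := by
      by_contra! hall
      refine hbot ((Subgroup.eq_bot_iff_forall P).mpr fun g _ => ?_)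
      exact FaithfulSMul.eq_of_smul_eq_smul (α := V) fun w => by
        rw [hall w, smul_zero, smul_zero]
    obtain ⟨v, hv⟩ := hne
    have hinj : Function.Injective fun g : P => (g : H) • v := by
      intro g k hgk
      have hgk' : (g : H) • v = (k : H) • v := hgk
      have := hfree ((k : H)⁻¹ * g) (P.mul_mem (P.inv_mem k.2) g.2) v hv
        (by rw [mul_smul, hgk', inv_smul_smul])
      exact Subtype.ext (inv_mul_eq_one.mp this).symm
    have hle := Nat.card_le_card_of_injective _ hinj
    have : Finite P := Finite.of_injective _ hinj
    obtain ⟨n, hn⟩ := IsPGroup.iff_card.mp hP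
    have h1 : Nat.card P ≠ 1 := by rwa [Ne, Subgroup.card_eq_one]
    have hn2 : n < 2 := (Nat.pow_lt_pow_iff_right hq.out.one_lt).mp (hn ▸ hle.trans_lt hlt)
    interval_cases n
    · exact absurd (hn.trans (pow_zero q)) h1
    · simpa using hn
  refine ⟨hfree, hcent, P.commute_pow_sub_one_of_card_eq_prime hq.out hcardP,
    fun h k v hv hh hk => ?_⟩
  have := hcent (h * k * (k * h)⁻¹) (P.commute_commutator_of_card_eq_prime hq.out hcardP h k) v hv
    (by rw [mul_inv_rev, mul_smul, mul_smul, mul_smul, inv_smul_eq_iff.mpr hk.symm,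
        inv_smul_eq_iff.mpr hh.symm, hk, hh])
  exact mul_inv_eq_one.mp this

end Action

section Degree16

variable {H V : Type*} [Group H] [AddCommGroup V] [DistribMulAction H V]

/-- In an elementary abelian 2-group, the subgroup `{0, v, w, v + w}`. -/
def kleinAddSubgroup (h2 : ∀ x : V, x + x = 0) (v w : V) : AddSubgroup V where
  carrier := {0, v, w, v + w}
  zero_mem' := by simp
  add_mem' := by
    rintro a b (rfl | rfl | rfl | rfl) (rfl | rfl | rfl | rfl) <;>
      simp [h2, add_left_comm, add_comm, add_eq_left]
  neg_mem' := by
    intro a ha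
    rwa [neg_eq_of_add_eq_zero_left (h2 a)]

theorem mem_kleinAddSubgroup {h2 : ∀ x : V, x + x = 0} {v w x : V} :
    x ∈ kleinAddSubgroup h2 v w ↔ x = 0 ∨ x = v ∨ x = w ∨ x = v + w := Iff.rfl

theorem card_kleinAddSubgroup (h2 : ∀ x : V, x + x = 0) {v w : V} (hv : v ≠ 0) (hw : w ≠ 0)
    (hvw : v ≠ w) : Nat.card (kleinAddSubgroup h2 v w) = 4 := by
  classical
  have h : v + w ≠ 0 := fun h => hvw ((eq_neg_of_add_eq_zero_left h).trans
    (neg_eq_of_add_eq_zero_left (h2 w)))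
  have : ((({0, v, w, v + w} : Finset V) : Set V)).ncard = 4 := by
    rw [Set.ncard_coe_finset, Finset.card_insert_of_notMem, Finset.card_insert_of_notMem,
      Finset.card_insert_of_notMem, Finset.card_singleton] <;>
      simp [hv, hw, hvw, hv.symm, hw.symm, h.symm]
  rw [← this, ← Nat.card_coe_set_eq]
  simp only [Finset.coe_insert, Finset.coe_singleton]
  rfl

/-- The stabilizers of a suitable vector and of a suitable subgroup of order 4 have exponent
dividing 4. -/
def HasSmallStabilizers16 (H V : Type*) [Group H] [AddCommGroup V] [DistribMulAction H V] : Prop :=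
  ∃ v : V, v ≠ 0 ∧ ∃ W : AddSubgroup V, Nat.card W = 4 ∧
    (∀ h : H, h • v = v → h ^ 4 = 1) ∧ (∀ h : H, (∀ w ∈ W, h • w ∈ W) → h ^ 4 = 1)

theorem card_modEq_one_cases {n q : ℕ} [Finite V] (hcard : Nat.card V = n)
    (hn : ∀ d ∈ n.divisors, d ≡ 1 [MOD q] → d = 1 ∨ d = n) (W : AddSubgroup V)
    (hW : Nat.card W ≡ 1 [MOD q]) : W = ⊥ ∨ W = ⊤ := by
  have hd := W.card_addSubgroup_dvd_card
  rw [hcard] at hd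
  have hn0 : n ≠ 0 := by
    rw [← hcard]; exact Nat.card_pos.ne'
  rcases hn _ (Nat.mem_divisors.mpr ⟨hd, hn0⟩) hW with h | h
  · exact Or.inl (AddSubgroup.card_eq_one.mp h)
  · exact Or.inr (AddSubgroup.eq_top_of_card_eq _ (h.trans hcard.symm))

theorem hasSmallStabilizers16_of_normal_five [Finite V] [FaithfulSMul H V]
    (hirr : IsIrreducibleAction H V) (hcard : Nat.card V = 16) (h2 : ∀ x : V, x + x = 0)
    {P : Subgroup H} [P.Normal] (hP : IsPGroup 5 P) (hbot : P ≠ ⊥) :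
    HasSmallStabilizers16 H V := by
  have : Fact (Nat.Prime 5) := ⟨by norm_num⟩
  obtain ⟨hfree, hcent, hpow, -⟩ := hirr.stabilizer_of_normal_qGroup hP hbot
    (by rw [hcard]; norm_num) (card_modEq_one_cases hcard (by decide))
  obtain ⟨a, haP, ha1⟩ := P.bot_or_exists_ne_one.resolve_left hbot
  have hord : ∀ m : ℕ, Nat.Coprime m 5 → a ^ m ≠ 1 := by
    intro m hm h
    obtain ⟨k, hk⟩ := hP ⟨a, haP⟩
    have hk' : a ^ 5 ^ k = 1 := congrArg Subtype.val hk
    have := pow_gcd_eq_one.mpr ⟨h, hk'⟩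
    rw [(hm.pow_right k : Nat.gcd m (5 ^ k) = 1), pow_one] at this
    exact ha1 this
  have : Nontrivial V := Finite.one_lt_card_iff_nontrivial.mp (by rw [hcard]; norm_num)
  obtain ⟨v, hv⟩ := exists_ne (0 : V)
  have hav : a • v ≠ v := fun h => ha1 (hfree a haP v hv h)
  have hav0 : a • v ≠ 0 := by rwa [Ne, smul_eq_zero_iff_eq]
  have haav : a • a • v ≠ v := fun h => hord 2 (by norm_num)
    (hfree _ (P.pow_mem haP 2) v hv (by rw [pow_two, mul_smul, h]))
  have hthree : a • a • v ≠ v + a • v := fun h => hord 3 (by norm_num)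
    (hfree _ (P.pow_mem haP 3) v hv (by
      rw [pow_succ, pow_two, mul_smul, mul_smul, h, smul_add, h, add_left_comm, h2, add_zero]))
  refine ⟨v, hv, kleinAddSubgroup h2 v (a • v), card_kleinAddSubgroup h2 hv hav0 hav.symm,
    fun h hh => ?_, fun h hh => ?_⟩
  · refine hcent _ (hpow h) v hv ?_
    simp only [pow_succ, pow_zero, one_mul, mul_smul, hh]
  · set y := h ^ 4 with hy
    have hyW : ∀ w ∈ kleinAddSubgroup h2 v (a • v), y • w ∈ kleinAddSubgroup h2 v (a • v) := by
      intro w hw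
      simp only [hy, pow_succ, pow_zero, one_mul, mul_smul]
      exact hh _ (hh _ (hh _ (hh _ hw)))
    have hya : y • a • v = a • y • v := by
      rw [← mul_smul, ← mul_smul, (hpow h a haP).eq]
    have h1 := hyW v (by simp [mem_kleinAddSubgroup])
    have h3 := hyW (a • v) (by simp [mem_kleinAddSubgroup])
    rw [hya] at h3
    rcases h1 with h1 | h1 | h1 | h1
    · exact absurd ((smul_eq_zero_iff_eq y).mp h1) hv
    · exact hcent y (hpow h) v hv h1
    · rw [h1] at h3
      rcases h3 with h3 | h3 | h3 | h3
      · exact absurd ((smul_eq_zero_iff_eq a).mp h3) hav0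
      · exact absurd h3 haav
      · exact absurd (smul_left_cancel a h3) hav
      · exact absurd h3 hthree
    · rw [h1, smul_add] at h3
      rcases h3 with h3 | h3 | h3 | h3
      · rw [← smul_add, smul_eq_zero_iff_eq] at h3
        exact absurd ((eq_neg_of_add_eq_zero_right h3).trans
          (neg_eq_of_add_eq_zero_left (h2 v))) hav
      · refine absurd ?_ hthree
        calc a • a • v = a • v + (a • v + a • a • v) := by rw [← add_assoc, h2, zero_add]
          _ = v + a • v := by rw [h3, add_comm]
      · rw [add_eq_left, smul_eq_zero_iff_eq] at h3
        exact absurd h3 hav0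
      · exact absurd (add_left_cancel (h3.trans (add_comm v _))) haav

theorem smul_smul_eq_of_card_eq_four (h2 : ∀ x : V, x + x = 0) {U : AddSubgroup V}
    (hU : Nat.card U = 4) {h : H} (hh : ∀ x ∈ U, h • x ∈ U) {u : V} (hu : u ∈ U) (hu0 : u ≠ 0)
    (hhu : h • u = u) {x : V} (hx : x ∈ U) : h • h • x = x := by
  by_cases hx0 : x = 0
  · simp [hx0]
  by_cases hxu : u = x
  · rw [← hxu, hhu, hhu]
  have hfin : Finite U := Nat.finite_of_card_ne_zero (by rw [hU]; norm_num)
  have hle : kleinAddSubgroup h2 u x ≤ U := by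
    rintro y (rfl | rfl | rfl | rfl)
    exacts [U.zero_mem, hu, hx, U.add_mem hu hx]
  have heq : kleinAddSubgroup h2 u x = U := by
    apply SetLike.coe_injective
    refine Set.eq_of_subset_of_ncard_le hle ?_ (Set.toFinite _)
    rw [← Nat.card_coe_set_eq, ← Nat.card_coe_set_eq]
    exact (hU.trans (card_kleinAddSubgroup h2 hu0 hx0 hxu).symm).le
  have := hh x hx
  rw [← heq] at this
  rcases this with h1 | h1 | h1 | h1
  · exact absurd ((smul_eq_zero_iff_eq h).mp h1) hx0
  · exact absurd (smul_left_cancel h (h1.trans hhu.symm)).symm hxu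
  · rw [h1, h1]
  · rw [h1, smul_add, hhu, h1, ← add_assoc, h2, zero_add]

theorem AddSubgroup.exists_add_of_card_mul [Finite V] {U₁ U₂ : AddSubgroup V}
    (hcard : Nat.card U₁ * Nat.card U₂ = Nat.card V) (hdisj : ∀ x ∈ U₁, x ∈ U₂ → x = 0) (v : V) :
    ∃ x ∈ U₁, ∃ y ∈ U₂, x + y = v := by
  have hinj : Function.Injective fun p : U₁ × U₂ => (p.1 : V) + p.2 := by
    rintro ⟨a, b⟩ ⟨c, d⟩ h
    have h' : (a : V) + b = c + d := h
    have hac : (a : V) - c = d - b := by rw [sub_eq_sub_iff_add_eq_add, h', add_comm]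
    have h0 := hdisj _ (U₁.sub_mem a.2 c.2) (hac ▸ U₂.sub_mem d.2 b.2)
    have h1 := hac ▸ h0
    exact Prod.ext (Subtype.ext (sub_eq_zero.mp h0)) (Subtype.ext (sub_eq_zero.mp h1).symm)
  have := (Nat.bijective_iff_injective_and_card _).mpr ⟨hinj, by rw [Nat.card_prod, hcard]⟩
  obtain ⟨p, hp⟩ := this.2 v
  exact ⟨p.1, p.1.2, p.2, p.2.2, hp⟩

theorem hasSmallStabilizers16_of_imprimitive [Finite V] [FaithfulSMul H V]
    (hcard : Nat.card V = 16) (h2 : ∀ x : V, x + x = 0) {U₁ U₂ : AddSubgroup V}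
    (hU₁ : Nat.card U₁ = 4) (hU₂ : Nat.card U₂ = 4) (hdisj : ∀ x ∈ U₁, x ∈ U₂ → x = 0)
    (hH : ∀ h : H, ((∀ x ∈ U₁, h • x ∈ U₁) ∧ (∀ x ∈ U₂, h • x ∈ U₂)) ∨
      ((∀ x ∈ U₁, h • x ∈ U₂) ∧ (∀ x ∈ U₂, h • x ∈ U₁))) :
    HasSmallStabilizers16 H V := by
  have hne : ∀ U : AddSubgroup V, Nat.card U = 4 → ∃ u ∈ U, u ≠ 0 := by
    intro U hU
    by_contra! h
    rw [(AddSubgroup.eq_bot_iff_forall U).mpr h, AddSubgroup.card_bot] at hU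
    norm_num at hU
  obtain ⟨u₁, hu₁, hu₁0⟩ := hne U₁ hU₁
  obtain ⟨u₂, hu₂, hu₂0⟩ := hne U₂ hU₂
  have hu12 : u₁ ≠ u₂ := fun h => hu₁0 (hdisj _ hu₁ (h ▸ hu₂))
  have hkey : ∀ h : H, h • h • u₁ = u₁ → h • h • u₂ = u₂ → h ^ 4 = 1 := by
    intro h h₁ h₂
    have hinv : (∀ x ∈ U₁, (h * h) • x ∈ U₁) ∧ (∀ x ∈ U₂, (h * h) • x ∈ U₂) := by
      simp only [mul_smul]
      rcases hH h with ⟨ha, hb⟩ | ⟨ha, hb⟩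
      · exact ⟨fun x hx => ha _ (ha _ hx), fun x hx => hb _ (hb _ hx)⟩
      · exact ⟨fun x hx => hb _ (ha _ hx), fun x hx => ha _ (hb _ hx)⟩
    refine FaithfulSMul.eq_of_smul_eq_smul (α := V) fun v => ?_
    obtain ⟨x, hx, y, hy, rfl⟩ := AddSubgroup.exists_add_of_card_mul
      (by rw [hU₁, hU₂, hcard]) hdisj v
    have hx' := smul_smul_eq_of_card_eq_four h2 hU₁ hinv.1 hu₁ hu₁0 (by rw [mul_smul, h₁]) hx
    have hy' := smul_smul_eq_of_card_eq_four h2 hU₂ hinv.2 hu₂ hu₂0 (by rw [mul_smul, h₂]) hy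
    rw [show h ^ 4 = (h * h) * (h * h) by simp only [pow_succ, pow_zero, one_mul, mul_assoc],
      mul_smul, smul_add, smul_add, hx', hy', one_smul]
  refine ⟨u₁ + u₂, fun h => hu12 ((eq_neg_of_add_eq_zero_left h).trans
    (neg_eq_of_add_eq_zero_left (h2 u₂))), kleinAddSubgroup h2 u₁ u₂,
    card_kleinAddSubgroup h2 hu₁0 hu₂0 hu12, fun h hh => ?_, fun h hh => ?_⟩
  · rw [smul_add] at hh
    have huniq : ∀ x ∈ U₁, ∀ y ∈ U₂, x + y = u₁ + u₂ → x = u₁ ∧ y = u₂ := by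
      intro x hx y hy hxy
      have hac : x - u₁ = u₂ - y := by rw [sub_eq_sub_iff_add_eq_add, hxy, add_comm]
      have h0 := hdisj _ (U₁.sub_mem hx hu₁) (hac ▸ U₂.sub_mem hu₂ hy)
      exact ⟨sub_eq_zero.mp h0, (sub_eq_zero.mp (hac ▸ h0)).symm⟩
    rcases hH h with ⟨ha, hb⟩ | ⟨ha, hb⟩
    · obtain ⟨e₁, e₂⟩ := huniq _ (ha _ hu₁) _ (hb _ hu₂) hh
      exact hkey h (by rw [e₁, e₁]) (by rw [e₂, e₂])
    · obtain ⟨e₂, e₁⟩ := huniq _ (hb _ hu₂) _ (ha _ hu₁) (by rw [add_comm, hh])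
      exact hkey h (by rw [e₁, e₂]) (by rw [e₂, e₁])
  · have hW₁ : ∀ x ∈ kleinAddSubgroup h2 u₁ u₂, x ∈ U₁ → x ≠ 0 → x = u₁ := by
      rintro x (rfl | rfl | rfl | rfl) hx hx0
      · exact absurd rfl hx0
      · rfl
      · exact absurd (hdisj _ hx hu₂) hx0
      · exact absurd (hdisj _ ((AddSubgroup.add_mem_cancel_left _ hu₁).mp hx) hu₂) hu₂0
    have hW₂ : ∀ x ∈ kleinAddSubgroup h2 u₁ u₂, x ∈ U₂ → x ≠ 0 → x = u₂ := by
      rintro x (rfl | rfl | rfl | rfl) hx hx0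
      · exact absurd rfl hx0
      · exact absurd (hdisj _ hu₁ hx) hx0
      · rfl
      · exact absurd (hdisj _ hu₁ ((AddSubgroup.add_mem_cancel_right _ hu₂).mp hx)) hu₁0
    have m₁ := hh u₁ (by simp [mem_kleinAddSubgroup])
    have m₂ := hh u₂ (by simp [mem_kleinAddSubgroup])
    have n₁ : h • u₁ ≠ 0 := by rwa [Ne, smul_eq_zero_iff_eq]
    have n₂ : h • u₂ ≠ 0 := by rwa [Ne, smul_eq_zero_iff_eq]
    rcases hH h with ⟨ha, hb⟩ | ⟨ha, hb⟩
    · have e₁ := hW₁ _ m₁ (ha _ hu₁) n₁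
      have e₂ := hW₂ _ m₂ (hb _ hu₂) n₂
      exact hkey h (by rw [e₁, e₁]) (by rw [e₂, e₂])
    · have e₁ := hW₂ _ m₁ (ha _ hu₁) n₁
      have e₂ := hW₁ _ m₂ (hb _ hu₂) n₂
      exact hkey h (by rw [e₁, e₂]) (by rw [e₂, e₁])

theorem sum_orbit_smul [Finite V] (P : Subgroup H) (v : V) {g : H} (hg : g ∈ P) :
    g • ∑ᶠ x ∈ MulAction.orbit P v, x = ∑ᶠ x ∈ MulAction.orbit P v, x := by
  have hfin : (MulAction.orbit P v).Finite := Set.toFinite _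
  rw [show g • ∑ᶠ x ∈ MulAction.orbit P v, x = DistribSMul.toAddMonoidHom V g
    (∑ᶠ x ∈ MulAction.orbit P v, x) from rfl, AddMonoidHom.map_finsum_mem _ _ hfin]
  refine finsum_mem_eq_of_bijOn (fun x => g • x) ⟨?_, ?_, ?_⟩ fun _ _ => rfl
  · intro x hx
    exact (MulAction.mem_orbit_of_mem_orbit (⟨g, hg⟩ : P) hx : _)
  · exact (MulAction.injective g).injOn
  · intro x hx
    refine ⟨g⁻¹ • x, MulAction.mem_orbit_of_mem_orbit (⟨g, hg⟩⁻¹ : P) hx, smul_inv_smul g x⟩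

/-- An orbit of length 3 of a fixed-point-free group, together with `0`, is a subgroup. -/
theorem exists_addSubgroup_of_ncard_orbit_eq_three [Finite V] (h2 : ∀ x : V, x + x = 0)
    {P : Subgroup H} (hfix : ∀ v : V, (∀ g ∈ P, g • v = v) → v = 0) {v : V} (hv : v ≠ 0)
    (ho : (MulAction.orbit P v).ncard = 3) :
    ∃ U : AddSubgroup V, Nat.card U = 4 ∧ ∀ x, x ∈ U ↔ x = 0 ∨ x ∈ MulAction.orbit P v := by
  obtain ⟨x, y, z, hxy, hxz, hyz, ho⟩ := Set.ncard_eq_three.mp ho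
  have hsum := hfix _ fun g hg => sum_orbit_smul P v hg
  have hz : x + (y + z) = 0 := by
    rw [← hsum, ho, finsum_mem_insert _ (by simp [hxy, hxz]) (Set.toFinite _),
      finsum_mem_pair hyz]
  have hz' : z = x + y := by
    rw [← add_assoc] at hz
    exact (eq_neg_of_add_eq_zero_right hz).trans (neg_eq_of_add_eq_zero_left (h2 _))
  have h0 : (0 : V) ∉ MulAction.orbit P v := by
    rintro ⟨g, hg⟩
    exact hv ((smul_eq_zero_iff_eq (g : H)).mp hg)
  have hx0 : x ≠ 0 := fun h => h0 (by simp [ho, h])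
  have hy0 : y ≠ 0 := fun h => h0 (by simp [ho, h])
  refine ⟨kleinAddSubgroup h2 x y, card_kleinAddSubgroup h2 hx0 hy0 hxy, fun w => ?_⟩
  rw [mem_kleinAddSubgroup, ho, ← hz']
  simp

/-- If all nonzero orbits have length 3 then the 3-group has order 3. -/
theorem card_eq_three_of_ncard_orbit [Finite V] [Nontrivial V] [FaithfulSMul H V]
    (h2 : ∀ x : V, x + x = 0) {P : Subgroup H} (hP : IsPGroup 3 P)
    (hfix : ∀ v : V, (∀ g ∈ P, g • v = v) → v = 0)
    (ho : ∀ v : V, v ≠ 0 → (MulAction.orbit P v).ncard = 3) : Nat.card P = 3 := by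
  have hfree : ∀ g ∈ P, ∀ v : V, v ≠ 0 → g • v = v → g = 1 := by
    intro g hg v hv hgv
    refine FaithfulSMul.eq_of_smul_eq_smul (α := V) fun w => ?_
    rw [one_smul]
    by_contra hgw
    have hw : w ≠ 0 := fun h => hgw (by rw [h, smul_zero])
    have hvw : v + w ≠ 0 := fun h => hgw (by
      rw [← (eq_neg_of_add_eq_zero_left h).trans (neg_eq_of_add_eq_zero_left (h2 w)), hgv])
    obtain ⟨L, hLc, hL⟩ := exists_addSubgroup_of_ncard_orbit_eq_three h2 hfix hw (ho w hw)
    obtain ⟨M, -, hM⟩ := exists_addSubgroup_of_ncard_orbit_eq_three h2 hfix hvw (ho _ hvw)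
    have hLg : ∀ x ∈ L, g • x ∈ L := by
      intro x hx
      rcases (hL x).mp hx with rfl | hx
      · rw [smul_zero]; exact L.zero_mem
      · exact (hL _).mpr (Or.inr (MulAction.mem_orbit_of_mem_orbit (⟨g, hg⟩ : P) hx))
    have hwL : w ∈ L := (hL w).mpr (Or.inr (MulAction.mem_orbit_self w))
    have hx1 : g • w + w ∈ L := L.add_mem (hLg w hwL) hwL
    have hx2 : g • w + w ∈ M := by
      have : g • w + w = g • (v + w) + (v + w) := by
        rw [smul_add, hgv, add_add_add_comm, h2, zero_add]
      rw [this]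
      exact M.add_mem ((hM _).mpr (Or.inr ⟨(⟨g, hg⟩ : P), rfl⟩))
        ((hM _).mpr (Or.inr (MulAction.mem_orbit_self _)))
    have hx0 : g • w + w ≠ 0 := fun h => hgw ((eq_neg_of_add_eq_zero_left h).trans
      (neg_eq_of_add_eq_zero_left (h2 w)))
    have hy1 := ((hL _).mp hx1).resolve_left hx0
    have hy2 := ((hM _).mp hx2).resolve_left hx0
    have hvwL : v + w ∈ L := by
      refine (hL _).mpr (Or.inr ?_)
      rw [← MulAction.orbit_eq_iff.mpr hy1, MulAction.orbit_eq_iff.mpr hy2]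
      exact MulAction.mem_orbit_self _
    have hvL : v ∈ L := (AddSubgroup.add_mem_cancel_right L hwL).mp hvwL
    have hsq := smul_smul_eq_of_card_eq_four h2 hLc hLg hvL hv hgv hwL
    obtain ⟨k, hk⟩ := hP ⟨g, hg⟩
    have hk' : g ^ 3 ^ k = 1 := congrArg Subtype.val hk
    have hst : g ^ 2 ∈ MulAction.stabilizer H w := by
      rw [MulAction.mem_stabilizer_iff, pow_two, mul_smul, hsq]
    obtain ⟨m, hm⟩ : Odd (3 ^ k) := Odd.pow (by decide)
    have h1 : (g ^ 2) ^ m * g = 1 := by rw [← pow_mul, ← pow_succ, ← hm, hk']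
    have h3 : g = ((g ^ 2) ^ m)⁻¹ := eq_inv_of_mul_eq_one_right h1
    have hmem : g ∈ MulAction.stabilizer H w := by
      rw [h3]
      exact inv_mem (pow_mem hst m)
    exact hgw hmem
  obtain ⟨v, hv⟩ := exists_ne (0 : V)
  rw [← ho v hv]
  refine Nat.card_congr (Equiv.ofInjective (fun g : P => g • v) fun g k hgk => ?_)
  have hgk' : (g : H) • v = (k : H) • v := hgk
  have := hfree ((k : H)⁻¹ * g) (P.mul_mem (P.inv_mem k.2) g.2) v hv
    (by rw [mul_smul, hgk', inv_smul_smul])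
  exact Subtype.ext (inv_mul_eq_one.mp this).symm

theorem smul_orbit_eq_orbit_smul_of_normal {X : Type*} [MulAction H X] (P : Subgroup H)
    [hn : P.Normal] (h : H) (v x : X) (hx : x ∈ MulAction.orbit P v) :
    h • x ∈ MulAction.orbit P (h • v) := by
  obtain ⟨g, rfl⟩ := hx
  refine ⟨⟨h * g * h⁻¹, hn.conj_mem g g.2 h⟩, ?_⟩
  change (h * (g : H) * h⁻¹) • h • v = h • (g : H) • v
  rw [mul_smul, mul_smul, inv_smul_smul]

theorem ncard_orbit_smul_of_normal {X : Type*} [Finite X] [MulAction H X] (P : Subgroup H)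
    [hn : P.Normal] (h : H) (v : X) :
    (MulAction.orbit P (h • v)).ncard = (MulAction.orbit P v).ncard := by
  rw [← Set.ncard_image_of_injective (MulAction.orbit P v) (MulAction.injective h)]
  congr 1
  ext x
  constructor
  · intro hx
    refine ⟨h⁻¹ • x, ?_, smul_inv_smul h x⟩
    simpa using smul_orbit_eq_orbit_smul_of_normal P h⁻¹ (h • v) x hx
  · rintro ⟨y, hy, rfl⟩
    exact smul_orbit_eq_orbit_smul_of_normal P h v y hy

theorem hasSmallStabilizers16_of_normal_three [Finite V] [FaithfulSMul H V]
    (hirr : IsIrreducibleAction H V) (hcard : Nat.card V = 16) (h2 : ∀ x : V, x + x = 0)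
    {P : Subgroup H} [P.Normal] (hP : IsPGroup 3 P) (hbot : P ≠ ⊥) :
    HasSmallStabilizers16 H V ∨ Nat.card P = 3 := by
  have : Fact (Nat.Prime 3) := ⟨by norm_num⟩
  have : Nontrivial V := Finite.one_lt_card_iff_nontrivial.mp (by rw [hcard]; norm_num)
  have hfix : ∀ v : V, (∀ g ∈ P, g • v = v) → v = 0 := fun v => hirr.eq_zero_of_fixed hbot
  by_cases hall : ∀ v : V, v ≠ 0 → (MulAction.orbit P v).ncard = 3
  · exact Or.inr (card_eq_three_of_ncard_orbit h2 hP hfix hall)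
  left
  have hz : ∀ v : V, v ≠ 0 → (0 : V) ∉ MulAction.orbit P v := by
    rintro v hv ⟨g, hg⟩
    exact hv ((smul_eq_zero_iff_eq (g : H)).mp hg)
  have hc0 : ({0}ᶜ : Set V).ncard = 15 := by
    rw [Set.ncard_compl, hcard, Set.ncard_singleton]
  have hsub : ∀ v : V, v ≠ 0 → MulAction.orbit P v ⊆ {0}ᶜ := fun v hv x hx h0 => by
    rw [Set.mem_singleton_iff.mp h0] at hx
    exact hz v hv hx
  have h39 : ∀ v : V, v ≠ 0 → (MulAction.orbit P v).ncard = 3 ∨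
      (MulAction.orbit P v).ncard = 9 := by
    intro v hv
    obtain ⟨n, hn⟩ := hP.card_orbit v
    rw [Nat.card_coe_set_eq] at hn
    have hle := Set.ncard_le_ncard (hsub v hv) (Set.toFinite _)
    rw [hc0, hn] at hle
    have hn3 : n < 3 := by
      by_contra! h
      have := Nat.pow_le_pow_right (show 0 < 3 by norm_num) h
      omega
    interval_cases n
    · refine absurd (hfix v fun g hg => ?_) hv
      obtain ⟨a, ha⟩ := Set.ncard_eq_one.mp hn
      have h1 : v ∈ MulAction.orbit P v := MulAction.mem_orbit_self v
      have h3 : g • v ∈ MulAction.orbit P v := ⟨(⟨g, hg⟩ : P), rfl⟩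
      rw [ha, Set.mem_singleton_iff] at h1 h3
      rw [h3, ← h1]
    · exact Or.inl hn
    · exact Or.inr hn
  push Not at hall
  obtain ⟨w, hw, hw3⟩ := hall
  have hw9 := (h39 w hw).resolve_left hw3
  have hdisj : ∀ a b : V, a ∉ MulAction.orbit P b →
      Disjoint (MulAction.orbit P a) (MulAction.orbit P b) := by
    intro a b hab
    rw [Set.disjoint_left]
    intro x hxa hxb
    rw [← MulAction.orbit_eq_iff.mpr hxb, MulAction.orbit_eq_iff.mpr hxa] at hab
    exact hab (MulAction.mem_orbit_self a)
  have hthree : ∀ v : V, v ≠ 0 → v ∉ MulAction.orbit P w → (MulAction.orbit P v).ncard = 3 := by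
    intro v hv hvw
    refine (h39 v hv).resolve_right fun h9 => ?_
    have := Set.ncard_le_ncard (Set.union_subset (hsub v hv) (hsub w hw)) (Set.toFinite _)
    rw [Set.ncard_union_eq (hdisj v w hvw), h9, hw9, hc0] at this
    omega
  obtain ⟨u₁, hu₁, hu₁w⟩ : ∃ u : V, u ≠ 0 ∧ u ∉ MulAction.orbit P w := by
    by_contra! h
    have := Set.ncard_le_ncard (show ({0}ᶜ : Set V) ⊆ MulAction.orbit P w from h) (Set.toFinite _)
    omega
  have h₁ := hthree u₁ hu₁ hu₁w
  obtain ⟨u₂, hu₂, hu₂w⟩ : ∃ u : V, u ≠ 0 ∧ u ∉ MulAction.orbit P w ∪ MulAction.orbit P u₁ := by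
    by_contra! h
    have := Set.ncard_le_ncard (show ({0}ᶜ : Set V) ⊆ _ from h) (Set.toFinite _)
    rw [Set.ncard_union_eq (hdisj u₁ w hu₁w).symm] at this
    omega
  rw [Set.mem_union, not_or] at hu₂w
  have h₂ := hthree u₂ hu₂ hu₂w.1
  have hcover : ∀ v : V, (MulAction.orbit P v).ncard = 3 → v ≠ 0 →
      v ∈ MulAction.orbit P u₁ ∨ v ∈ MulAction.orbit P u₂ := by
    have heq : MulAction.orbit P w ∪ MulAction.orbit P u₁ ∪ MulAction.orbit P u₂ = {0}ᶜ := by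
      refine Set.eq_of_subset_of_ncard_le (Set.union_subset (Set.union_subset
        (hsub w hw) (hsub _ hu₁)) (hsub _ hu₂)) ?_ (Set.toFinite _)
      rw [Set.ncard_union_eq, Set.ncard_union_eq (hdisj u₁ w hu₁w).symm, hw9, h₁, h₂, hc0]
      rw [Set.disjoint_union_left]
      exact ⟨(hdisj _ _ hu₂w.1).symm, (hdisj _ _ hu₂w.2).symm⟩
    intro v hv hv0
    have : v ∈ ({0}ᶜ : Set V) := hv0
    rw [← heq] at this
    rcases this with (h | h) | h
    · rw [MulAction.orbit_eq_iff.mpr h] at hv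
      omega
    · exact Or.inl h
    · exact Or.inr h
  obtain ⟨U₁, hU₁, mU₁⟩ := exists_addSubgroup_of_ncard_orbit_eq_three h2 hfix hu₁ h₁
  obtain ⟨U₂, hU₂, mU₂⟩ := exists_addSubgroup_of_ncard_orbit_eq_three h2 hfix hu₂ h₂
  refine hasSmallStabilizers16_of_imprimitive hcard h2 hU₁ hU₂ (fun x hx₁ hx₂ => ?_) fun h => ?_
  · by_contra hx0
    exact Set.disjoint_left.mp (hdisj u₂ u₁ hu₂w.2) (((mU₂ x).mp hx₂).resolve_left hx0)
      (((mU₁ x).mp hx₁).resolve_left hx0)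
  · have hmap : ∀ (u u' : V) (U U' : AddSubgroup V),
        (∀ x, x ∈ U ↔ x = 0 ∨ x ∈ MulAction.orbit P u) →
        (∀ x, x ∈ U' ↔ x = 0 ∨ x ∈ MulAction.orbit P u') → h • u ∈ MulAction.orbit P u' →
        ∀ x ∈ U, h • x ∈ U' := by
      intro u u' U U' hU hU' huu x hx
      rcases (hU x).mp hx with rfl | hx
      · rw [smul_zero]; exact U'.zero_mem
      · refine (hU' _).mpr (Or.inr ?_)
        rw [← MulAction.orbit_eq_iff.mpr huu]
        exact smul_orbit_eq_orbit_smul_of_normal P h u x hx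
    have hback : ∀ a b c : V, h • a ∈ MulAction.orbit P c → h • b ∈ MulAction.orbit P c →
        b ∈ MulAction.orbit P a := by
      intro a b c ha hb
      rw [← MulAction.orbit_eq_iff.mpr ha] at hb
      simpa using smul_orbit_eq_orbit_smul_of_normal P h⁻¹ _ _ hb
    have c₁ := hcover (h • u₁) (by rw [ncard_orbit_smul_of_normal, h₁])
      (by rwa [Ne, smul_eq_zero_iff_eq])
    have c₂ := hcover (h • u₂) (by rw [ncard_orbit_smul_of_normal, h₂])
      (by rwa [Ne, smul_eq_zero_iff_eq])
    rcases c₁ with c₁ | c₁ <;> rcases c₂ with c₂ | c₂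
    · exact absurd (hback _ _ _ c₁ c₂) hu₂w.2
    · exact Or.inl ⟨hmap _ _ _ _ mU₁ mU₁ c₁, hmap _ _ _ _ mU₂ mU₂ c₂⟩
    · exact Or.inr ⟨hmap _ _ _ _ mU₁ mU₂ c₁, hmap _ _ _ _ mU₂ mU₁ c₂⟩
    · exact absurd (hback _ _ _ c₁ c₂) hu₂w.2

/-- A group whose normal subgroup of order 3 is self-centralizing acts reducibly on `2 ^ 4`. -/
theorem centralizer_not_le_of_card_eq_three [Finite H] [Finite V] [FaithfulSMul H V]
    (hirr : IsIrreducibleAction H V) (hcard : Nat.card V = 16) (h2 : ∀ x : V, x + x = 0)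
    {P : Subgroup H} [P.Normal] (hP : Nat.card P = 3) :
    ¬ Subgroup.centralizer (P : Set H) ≤ P := by
  intro hC
  have : Fact (Nat.Prime 2) := ⟨by norm_num⟩
  have : Fact (Nat.Prime 3) := ⟨by norm_num⟩
  have hbot : P ≠ ⊥ := fun h => by rw [h, Subgroup.card_bot] at hP; norm_num at hP
  have hP3 : IsPGroup 3 P := IsPGroup.of_card (n := 1) (by rw [hP]; norm_num)
  have hfix : ∀ v : V, (∀ g ∈ P, g • v = v) → v = 0 := fun v => hirr.eq_zero_of_fixed hbot
  have hsq : ∀ h : H, h ^ 2 ∈ P := fun h => hC (Subgroup.mem_centralizer_iff.mpr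
    (P.commute_pow_sub_one_of_card_eq_prime (by norm_num) hP h))
  have hquot : IsPGroup 2 (H ⧸ P) := by
    intro x
    obtain ⟨h, rfl⟩ := QuotientGroup.mk_surjective x
    exact ⟨1, by rw [← QuotientGroup.mk_pow, QuotientGroup.eq_one_iff]; exact hsq h⟩
  obtain ⟨Q⟩ : Nonempty (Sylow 2 H) := inferInstance
  have htop : P ⊔ (Q : Subgroup H) = ⊤ := by
    rw [← Subgroup.index_eq_one]
    obtain ⟨n, hn⟩ := IsPGroup.iff_card.mp hquot
    have h₁ : (P ⊔ (Q : Subgroup H)).index ∣ 2 ^ n := by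
      rw [← hn]; exact Subgroup.index_dvd_of_le le_sup_left
    have h₂ : (P ⊔ (Q : Subgroup H)).index ∣ (Q : Subgroup H).index :=
      Subgroup.index_dvd_of_le le_sup_right
    obtain ⟨m, -, hm⟩ := (Nat.dvd_prime_pow Nat.prime_two).mp h₁
    rcases Nat.eq_zero_or_pos m with h0 | h0
    · rw [hm, h0, pow_zero]
    · exact absurd ((dvd_pow_self 2 h0.ne').trans (hm ▸ h₂)) Q.not_dvd_index
  obtain ⟨v, hvQ, hv⟩ : ∃ v : V, (∀ g ∈ (Q : Subgroup H), g • v = v) ∧ v ≠ 0 := by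
    by_contra! h
    have := card_modEq_one_of_fixed_eq_zero Q.2 h ⊤ fun _ _ _ _ => AddSubgroup.mem_top _
    rw [AddSubgroup.card_top, hcard] at this
    exact absurd this (by decide)
  have ho : (MulAction.orbit P v).ncard = 3 := by
    obtain ⟨n, hn⟩ := hP3.card_orbit v
    have hle : Nat.card (MulAction.orbit P v) ≤ Nat.card P :=
      Nat.card_le_card_of_surjective (fun g : P => ⟨g • v, MulAction.mem_orbit v g⟩)
        fun ⟨x, g, hg⟩ => ⟨g, Subtype.ext hg⟩
    rw [hn, hP] at hle
    have hn2 : n < 2 := by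
      by_contra! h
      have := Nat.pow_le_pow_right (show 0 < 3 by norm_num) h
      omega
    rw [Nat.card_coe_set_eq] at hn
    interval_cases n
    · refine absurd (hfix v fun g hg => ?_) hv
      obtain ⟨a, ha⟩ := Set.ncard_eq_one.mp hn
      have h1 : v ∈ MulAction.orbit P v := MulAction.mem_orbit_self v
      have h3 : g • v ∈ MulAction.orbit P v := ⟨(⟨g, hg⟩ : P), rfl⟩
      rw [ha, Set.mem_singleton_iff] at h1 h3
      rw [h3, ← h1]
    · exact hn
  obtain ⟨U, hU, mU⟩ := exists_addSubgroup_of_ncard_orbit_eq_three h2 hfix hv ho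
  have hHv : ∀ h : H, h • v ∈ MulAction.orbit P v := by
    intro h
    have hmem : h ∈ P ⊔ (Q : Subgroup H) := htop ▸ Subgroup.mem_top h
    obtain ⟨p, hp, q, hq, rfl⟩ := Subgroup.mem_sup_of_normal_left.mp hmem
    exact ⟨⟨p, hp⟩, by rw [mul_smul, hvQ q hq]; rfl⟩
  rcases hirr U fun h w hw => by
    rcases (mU w).mp hw with rfl | hw
    · rw [smul_zero]; exact U.zero_mem
    · refine (mU _).mpr (Or.inr ?_)
      rw [← MulAction.orbit_eq_iff.mpr (hHv h)]
      exact smul_orbit_eq_orbit_smul_of_normal P h v w hw with h | h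
  · rw [h, AddSubgroup.card_bot] at hU
    norm_num at hU
  · rw [h, AddSubgroup.card_top, hcard] at hU
    norm_num at hU

theorem IsIrreducibleAction.hasSmallStabilizers16 [Finite H] [Group.IsSolvable H] [Finite V]
    [FaithfulSMul H V] (hirr : IsIrreducibleAction H V) (hcard : Nat.card V = 16)
    (h2 : ∀ x : V, x + x = 0) : HasSmallStabilizers16 H V := by
  have hprime : ∀ (r : ℕ) (P : Subgroup H), r.Prime → P.Normal → IsPGroup r P → P ≠ ⊥ →
      r = 3 ∨ r = 5 := by
    intro r P hr hn hP hbot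
    have : Fact r.Prime := ⟨hr⟩
    have := card_modEq_one_of_fixed_eq_zero hP (fun v : V => hirr.eq_zero_of_fixed hbot) ⊤
      fun _ _ _ _ => AddSubgroup.mem_top _
    rw [AddSubgroup.card_top, hcard] at this
    have hdvd : r ∣ 3 * 5 := (Nat.modEq_iff_dvd' (by norm_num)).mp this.symm
    rcases (Nat.Prime.dvd_mul hr).mp hdvd with h | h
    · exact Or.inl ((Nat.prime_dvd_prime_iff_eq hr (by norm_num)).mp h)
    · exact Or.inr ((Nat.prime_dvd_prime_iff_eq hr (by norm_num)).mp h)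
  have htriv : ¬ Subgroup.centralizer ((⊥ : Subgroup H) : Set H) ≤ ⊥ := by
    intro h
    have hone : ∀ x : H, x = 1 := fun x => Subgroup.mem_bot.mp
      (h (Subgroup.mem_centralizer_iff.mpr fun y hy => by
        rw [Subgroup.mem_bot.mp hy, one_mul, mul_one]))
    have : Nontrivial V := Finite.one_lt_card_iff_nontrivial.mp (by rw [hcard]; norm_num)
    obtain ⟨v, hv⟩ := exists_ne (0 : V)
    have : Nat.card (AddSubgroup.zmultiples v) = 2 := by
      rw [Nat.card_zmultiples]
      exact addOrderOf_eq_prime (by rw [two_nsmul, h2]) hv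
    rcases hirr (AddSubgroup.zmultiples v) fun x w hw => by rwa [hone x, one_smul] with h | h
    · exact hv (AddSubgroup.zmultiples_eq_bot.mp h)
    · rw [h, AddSubgroup.card_top, hcard] at this
      norm_num at this
  obtain ⟨r, P, hr, hn, hP, hbot, -, -⟩ := exists_normal_isPGroup_le_centralizer ⊥ htriv
  rw [le_bot_iff] at hbot
  rcases hprime r P hr hn hP hbot with rfl | rfl
  swap
  · exact hasSmallStabilizers16_of_normal_five hirr hcard h2 hP hbot
  rcases hasSmallStabilizers16_of_normal_three hirr hcard h2 hP hbot with h | hP3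
  · exact h
  obtain ⟨s, R, hs, hRn, hR, hRP, -, -⟩ := exists_normal_isPGroup_le_centralizer P
    (centralizer_not_le_of_card_eq_three hirr hcard h2 hP3)
  have hRbot : R ≠ ⊥ := fun h => hRP (h ▸ bot_le)
  rcases hprime s R hs hRn hR hRbot with rfl | rfl
  swap
  · exact hasSmallStabilizers16_of_normal_five hirr hcard h2 hR hRbot
  have hPR : P ⊔ R ≠ ⊥ := fun h => hbot (le_bot_iff.mp (h ▸ le_sup_left))
  refine (hasSmallStabilizers16_of_normal_three hirr hcard h2
    (hP.to_sup_of_normal_left hR) hPR).resolve_right fun h3 => hRP ?_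
  have := Subgroup.eq_of_le_of_card_ge (le_sup_left : P ≤ P ⊔ R) (h3.trans hP3.symm).le
  rw [this]
  exact le_sup_right

end Degree16

section Degree27

variable {H V : Type*} [Group H] [AddCommGroup V] [DistribMulAction H V]

/-- In an elementary abelian 3-group, the subgroup `{0, v, -v}`. -/
def lineAddSubgroup (h3 : ∀ x : V, x + x + x = 0) (v : V) : AddSubgroup V where
  carrier := {0, v, -v}
  zero_mem' := by simp
  add_mem' := by
    have hv : v + v = -v := eq_neg_of_add_eq_zero_left (h3 v)
    have hv' : -v + -v = v := by rw [← neg_add, hv, neg_neg]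
    rintro a b (rfl | rfl | rfl) (rfl | rfl | rfl) <;> simp [hv, hv']
  neg_mem' := by rintro a (rfl | rfl | rfl) <;> simp

theorem mem_lineAddSubgroup {h3 : ∀ x : V, x + x + x = 0} {v x : V} :
    x ∈ lineAddSubgroup h3 v ↔ x = 0 ∨ x = v ∨ x = -v := Iff.rfl

theorem self_mem_lineAddSubgroup (h3 : ∀ x : V, x + x + x = 0) (v : V) :
    v ∈ lineAddSubgroup h3 v := Or.inr (Or.inl rfl)

theorem eq_zero_of_eq_neg_of_add_add_eq_zero (h3 : ∀ x : V, x + x + x = 0) {v : V}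
    (h : v = -v) : v = 0 := by
  have h' : v + v = 0 := by nth_rewrite 2 [h]; exact add_neg_cancel v
  have := h3 v
  rwa [h', zero_add] at this

theorem card_lineAddSubgroup (h3 : ∀ x : V, x + x + x = 0) {v : V} (hv : v ≠ 0) :
    Nat.card (lineAddSubgroup h3 v) = 3 := by
  have hne : v ≠ -v := fun h => hv (eq_zero_of_eq_neg_of_add_add_eq_zero h3 h)
  have : ({0, v, -v} : Set V).ncard = 3 :=
    Set.ncard_eq_three.mpr ⟨0, v, -v, hv.symm, (neg_ne_zero.mpr hv).symm, hne, rfl⟩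
  rw [← this, ← Nat.card_coe_set_eq]
  rfl

theorem AddSubgroup.card_sup_of_disjoint {U₁ U₂ : AddSubgroup V}
    (hdisj : ∀ x ∈ U₁, x ∈ U₂ → x = 0) :
    Nat.card (U₁ ⊔ U₂ : AddSubgroup V) = Nat.card U₁ * Nat.card U₂ := by
  rw [← Nat.card_prod]
  refine (Nat.card_congr (Equiv.ofBijective
    (fun p : U₁ × U₂ => (⟨p.1 + p.2, AddSubgroup.mem_sup.mpr
      ⟨p.1, p.1.2, p.2, p.2.2, rfl⟩⟩ : (U₁ ⊔ U₂ : AddSubgroup V))) ⟨?_, ?_⟩)).symm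
  · rintro ⟨a, b⟩ ⟨c, d⟩ h
    have h' : (a : V) + b = c + d := congrArg Subtype.val h
    have hac : (a : V) - c = d - b := by rw [sub_eq_sub_iff_add_eq_add, h', add_comm]
    have h0 := hdisj _ (U₁.sub_mem a.2 c.2) (hac ▸ U₂.sub_mem d.2 b.2)
    have h1 := hac ▸ h0
    exact Prod.ext (Subtype.ext (sub_eq_zero.mp h0)) (Subtype.ext (sub_eq_zero.mp h1).symm)
  · rintro ⟨x, hx⟩
    obtain ⟨y, hy, z, hz, rfl⟩ := AddSubgroup.mem_sup.mp hx
    exact ⟨(⟨y, hy⟩, ⟨z, hz⟩), rfl⟩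

theorem IsIrreducibleAction.eq_top_of_orbit_mem (hirr : IsIrreducibleAction H V) {v : V}
    (hv : v ≠ 0) {U : AddSubgroup V} (hU : ∀ h : H, h • v ∈ U) : U = ⊤ := by
  let W : AddSubgroup V :=
    { carrier := {x | ∀ h : H, h • x ∈ U}
      add_mem' := fun ha hb h => by rw [smul_add]; exact U.add_mem (ha h) (hb h)
      zero_mem' := fun h => by rw [smul_zero]; exact U.zero_mem
      neg_mem' := fun ha h => by rw [smul_neg]; exact U.neg_mem (ha h) }
  rcases hirr W fun h w hw k => by rw [← mul_smul]; exact hw (k * h) with h | h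
  · have : v ∈ W := hU
    rw [h] at this
    exact absurd this hv
  · refine eq_top_iff.mpr fun x _ => ?_
    have : x ∈ W := h ▸ AddSubgroup.mem_top x
    simpa using this 1

/-- The stabilizer of a suitable nonzero vector is an extension of an elementary abelian 3-group
by a 2-group. -/
def HasSmallStabilizers27 (H V : Type*) [Group H] [AddCommGroup V] [DistribMulAction H V] : Prop :=
  ∃ v : V, v ≠ 0 ∧ (∀ h : H, h • v = v → ∃ k : ℕ, h ^ (2 ^ k * 3) = 1) ∧
    (∀ h k : H, h • v = v → k • v = v → h ^ 3 = 1 → k ^ 3 = 1 → Commute h k)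

theorem hasSmallStabilizers27_of_normal_thirteen [Finite V] [FaithfulSMul H V]
    (hirr : IsIrreducibleAction H V) (hcard : Nat.card V = 27) {P : Subgroup H} [P.Normal]
    (hP : IsPGroup 13 P) (hbot : P ≠ ⊥) : HasSmallStabilizers27 H V := by
  have : Fact (Nat.Prime 13) := ⟨by norm_num⟩
  obtain ⟨-, hcent, hpow, hcomm⟩ := hirr.stabilizer_of_normal_qGroup hP hbot
    (by rw [hcard]; norm_num) (card_modEq_one_cases hcard (by decide))
  have : Nontrivial V := Finite.one_lt_card_iff_nontrivial.mp (by rw [hcard]; norm_num)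
  obtain ⟨v, hv⟩ := exists_ne (0 : V)
  refine ⟨v, hv, fun h hh => ⟨2, hcent _ (hpow h) v hv ?_⟩,
    fun h k hh hk _ _ => hcomm h k v hv hh hk⟩
  have : h ∈ MulAction.stabilizer H v := hh
  exact pow_mem this 12

/-- If every translate of a line `L` either is `L` or lies in `M`, with `L ∩ M = 0`, then `L` and
its translates form a frame of `V`, and vectors of `L` have stabilizers of exponent 4. -/
theorem hasSmallStabilizers27_of_line [Finite V] [FaithfulSMul H V]
    (hirr : IsIrreducibleAction H V) (hcard : Nat.card V = 27) (h3 : ∀ x : V, x + x + x = 0)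
    {v : V} (hv : v ≠ 0) {M : AddSubgroup V} (hvM : v ∉ M)
    (hH : ∀ h : H, h • v ∈ lineAddSubgroup h3 v ∨ h • v ∈ M) : HasSmallStabilizers27 H V := by
  have hline : ∀ {a x : V}, x ∈ lineAddSubgroup h3 a → x ≠ 0 → a ∈ lineAddSubgroup h3 x := by
    rintro a x (rfl | rfl | rfl) hx
    exacts [absurd rfl hx, Or.inr (Or.inl rfl), Or.inr (Or.inr (neg_neg a).symm)]
  have hle : ∀ {a : V} {U : AddSubgroup V}, a ∈ U → lineAddSubgroup h3 a ≤ U := by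
    rintro a U ha x (rfl | rfl | rfl)
    exacts [U.zero_mem, ha, U.neg_mem ha]
  have hsmul : ∀ {a x : V} (h : H), x ∈ lineAddSubgroup h3 a →
      h • x ∈ lineAddSubgroup h3 (h • a) := by
    rintro a x h (rfl | rfl | rfl)
    · rw [smul_zero]; exact AddSubgroup.zero_mem _
    · exact self_mem_lineAddSubgroup h3 _
    · rw [smul_neg]; exact AddSubgroup.neg_mem _ (self_mem_lineAddSubgroup h3 _)
  have hdisj : ∀ {a : V} {U : AddSubgroup V}, a ∉ U →
      ∀ x ∈ lineAddSubgroup h3 a, x ∈ U → x = 0 := by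
    intro a U ha x hx hxU
    by_contra hx0
    exact ha (hle hxU (hline hx hx0))
  obtain ⟨h₁, hh₁⟩ : ∃ h : H, h • v ∉ lineAddSubgroup h3 v := by
    by_contra! h
    have := card_lineAddSubgroup h3 hv
    rw [hirr.eq_top_of_orbit_mem hv h, AddSubgroup.card_top, hcard] at this
    norm_num at this
  set b := h₁ • v with hb
  have hb0 : b ≠ 0 := by rwa [hb, Ne, smul_eq_zero_iff_eq]
  set K := lineAddSubgroup h3 v ⊔ lineAddSubgroup h3 b with hK
  have hKcard : Nat.card K = 9 := by
    rw [hK, sup_comm, AddSubgroup.card_sup_of_disjoint (hdisj hh₁), card_lineAddSubgroup h3 hv,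
      card_lineAddSubgroup h3 hb0]
  obtain ⟨h₂, hh₂⟩ : ∃ h : H, h • v ∉ K := by
    by_contra! h
    rw [hirr.eq_top_of_orbit_mem hv h, AddSubgroup.card_top, hcard] at hKcard
    norm_num at hKcard
  set c := h₂ • v with hc
  have hc0 : c ≠ 0 := by rwa [hc, Ne, smul_eq_zero_iff_eq]
  have hcv : c ∉ lineAddSubgroup h3 v := fun h => hh₂ ((le_sup_left : _ ≤ K) h)
  have hcb : c ∉ lineAddSubgroup h3 b := fun h => hh₂ ((le_sup_right : _ ≤ K) h)
  have hbM : b ∈ M := (hH h₁).resolve_left hh₁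
  have hcM : c ∈ M := (hH h₂).resolve_left hcv
  have hdecomp : ∀ x : V, ∃ l ∈ lineAddSubgroup h3 v, ∃ β ∈ lineAddSubgroup h3 b,
      ∃ γ ∈ lineAddSubgroup h3 c, x = l + β + γ := by
    intro x
    obtain ⟨y, hy, γ, hγ, rfl⟩ := AddSubgroup.exists_add_of_card_mul
      (U₁ := K) (U₂ := lineAddSubgroup h3 c) (by rw [hKcard, card_lineAddSubgroup h3 hc0, hcard])
      (fun x hx hx' => hdisj hh₂ x hx' hx) x
    obtain ⟨l, hl, β, hβ, rfl⟩ := AddSubgroup.mem_sup.mp hy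
    exact ⟨l, hl, β, hβ, γ, hγ, rfl⟩
  have htrans : ∀ h k : H, k • v ∈ lineAddSubgroup h3 (h • v) ∨ h⁻¹ • k • v ∈ M := by
    intro h k
    rcases hH (h⁻¹ * k) with h' | h'
    · left
      have := hsmul h h'
      rwa [mul_smul, smul_inv_smul] at this
    · right
      rwa [mul_smul] at h'
  have hframe : ∀ k : H, k • v ∉ lineAddSubgroup h3 v →
      k • v ∈ lineAddSubgroup h3 b ∨ k • v ∈ lineAddSubgroup h3 c := by
    intro k hk
    have hkM : k • v ∈ M := (hH k).resolve_left hk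
    obtain ⟨l, hl, β, hβ, γ, hγ, hx⟩ := hdecomp (k • v)
    have hl0 : l = 0 := hdisj hvM l hl (by
      have : l = k • v - β - γ := by rw [hx]; abel
      rw [this]
      exact M.sub_mem (M.sub_mem hkM (hle hbM hβ)) (hle hcM hγ))
    rw [hl0, zero_add] at hx
    by_contra! hcon
    have k₁ := (htrans h₁ k).resolve_left hcon.1
    have k₂ := (htrans h₂ k).resolve_left hcon.2
    have c₁ : h₁⁻¹ • c ∈ M := (htrans h₁ h₂).resolve_left hcb
    have b₂ : h₂⁻¹ • b ∈ M := (htrans h₂ h₁).resolve_left fun h => hcb (hline h hb0)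
    have hβ0 : β = 0 := by
      rw [← smul_eq_zero_iff_eq h₁⁻¹]
      have e₁ := hsmul h₁⁻¹ hβ
      rw [hb, inv_smul_smul] at e₁
      refine hdisj hvM _ e₁ ?_
      have : h₁⁻¹ • β = h₁⁻¹ • k • v - h₁⁻¹ • γ := by rw [hx, smul_add]; abel
      rw [this]
      exact M.sub_mem k₁ (hle c₁ (hsmul h₁⁻¹ hγ))
    refine hcon.2 ?_
    rw [hx, hβ0, zero_add]
    exact hγ
  have hfour : ∀ h : H, h • v = v → h ^ 4 = 1 := by
    intro h hhv
    have hout : ∀ k : H, k • v ∉ lineAddSubgroup h3 v →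
        h • k • v ∈ lineAddSubgroup h3 b ∨ h • k • v ∈ lineAddSubgroup h3 c := by
      intro k hk
      rw [← mul_smul]
      refine hframe _ fun hmem => hk ?_
      have := hsmul h⁻¹ hmem
      rwa [mul_smul, inv_smul_smul, inv_smul_eq_iff.mpr hhv.symm] at this
    have hback : ∀ a : V, h • b ∈ lineAddSubgroup h3 a → h • c ∈ lineAddSubgroup h3 a → False := by
      intro a hba hca
      have h0 : h • b ≠ 0 := by rwa [Ne, smul_eq_zero_iff_eq]
      have h1 := hle (hline hba h0) hca
      have h2 := hsmul h⁻¹ h1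
      rw [inv_smul_smul, inv_smul_smul] at h2
      exact hcb h2
    have hsq : h • h • b ∈ lineAddSubgroup h3 b ∧ h • h • c ∈ lineAddSubgroup h3 c := by
      rcases hout h₁ hh₁ with hb' | hb' <;> rcases hout h₂ hcv with hc' | hc'
      · exact (hback _ hb' hc').elim
      · exact ⟨hle hb' (hsmul h hb'), hle hc' (hsmul h hc')⟩
      · exact ⟨hle hc' (hsmul h hb'), hle hb' (hsmul h hc')⟩
      · exact (hback _ hb' hc').elim
    have hfourth : ∀ a : V, a ≠ 0 → h • h • a ∈ lineAddSubgroup h3 a →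
        ∀ x ∈ lineAddSubgroup h3 a, h ^ 4 • x = x := by
      intro a ha hha x hx
      have h4 : h ^ 4 • a = a := by
        simp only [pow_succ, pow_zero, one_mul, mul_smul]
        rcases hha with e | e | e
        · rw [smul_eq_zero_iff_eq, smul_eq_zero_iff_eq] at e
          exact absurd e ha
        · rw [e, e]
        · rw [e, smul_neg, smul_neg, e, neg_neg]
      rcases hx with rfl | rfl | rfl
      · exact smul_zero _
      · exact h4
      · rw [smul_neg, h4]
    refine FaithfulSMul.eq_of_smul_eq_smul (α := V) fun x => ?_
    obtain ⟨l, hl, β, hβ, γ, hγ, rfl⟩ := hdecomp x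
    rw [smul_add, smul_add,
      hfourth v hv (by rw [hhv, hhv]; exact self_mem_lineAddSubgroup h3 v) l hl,
      hfourth b hb0 hsq.1 β hβ, hfourth c hc0 hsq.2 γ hγ, one_smul]
  have hone : ∀ h : H, h • v = v → h ^ 3 = 1 → h = 1 := by
    intro h hh hh3
    have := hfour h hh
    rwa [pow_succ, hh3, one_mul] at this
  refine ⟨v, hv, fun h hh => ⟨2, by rw [pow_mul, show 2 ^ 2 = 4 from rfl, hfour h hh, one_pow]⟩,
    fun h k hh hk hh3 hk3 => ?_⟩
  rw [hone h hh hh3, hone k hk hk3]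

theorem exists_signed_vector_of_isPGroup_two [Finite V] (hcard : Nat.card V = 27)
    (h3 : ∀ x : V, x + x + x = 0) {P : Subgroup H} (hP : IsPGroup 2 P) :
    ∃ v : V, v ≠ 0 ∧ ∀ g ∈ P, g • v = v ∨ g • v = -v := by
  classical
  have : Fact (Nat.Prime 2) := ⟨Nat.prime_two⟩
  have : Fintype V := Fintype.ofFinite V
  let f : V → Set V := fun v => {v, -v}
  have hf : ∀ a b : V, f a = f b ↔ a = b ∨ a = -b := by
    intro a b
    rw [Set.pair_eq_pair_iff]
    constructor
    · rintro (⟨h, -⟩ | ⟨h, -⟩)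
      exacts [Or.inl h, Or.inr h]
    · rintro (rfl | rfl)
      exacts [Or.inl ⟨rfl, rfl⟩, Or.inr ⟨rfl, neg_neg b⟩]
  have hsm : ∀ (g : H) (v : V), g • f v = f (g • v) := by
    intro g v
    simp [f, Set.smul_set_insert]
  let s : Finset V := Finset.univ.erase 0
  have hs : s.card = 26 := by
    rw [Finset.card_erase_of_mem (Finset.mem_univ _), Finset.card_univ, ← Nat.card_eq_fintype_card,
      hcard]
  have hcount : (s.image f).card = 13 := by
    have h1 := Finset.card_eq_sum_card_image f s
    rw [Finset.sum_const_nat (m := 2)] at h1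
    · omega
    · intro t ht
      obtain ⟨v, hvs, rfl⟩ := Finset.mem_image.mp ht
      have hv : v ≠ 0 := (Finset.mem_erase.mp hvs).1
      have : {a ∈ s | f a = f v} = {v, -v} := by
        ext a
        simp only [Finset.mem_filter, hf, Finset.mem_insert, Finset.mem_singleton, s,
          Finset.mem_erase, Finset.mem_univ, and_true]
        constructor
        · exact fun h => h.2
        · rintro (rfl | rfl)
          exacts [⟨hv, Or.inl rfl⟩, ⟨neg_ne_zero.mpr hv, Or.inr rfl⟩]
      rw [this, Finset.card_pair fun h => hv (eq_zero_of_eq_neg_of_add_add_eq_zero h3 h)]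
  have key := hP.ncard_modEq_ncard_fixed ((s.image f : Finset (Set V)) : Set (Set V)) (by
    intro g _ t ht
    obtain ⟨v, hvs, rfl⟩ := Finset.mem_image.mp (Finset.mem_coe.mp ht)
    refine Finset.mem_coe.mpr (Finset.mem_image.mpr ⟨g • v, ?_, (hsm g v).symm⟩)
    rw [Finset.mem_erase] at hvs ⊢
    exact ⟨by rw [Ne, smul_eq_zero_iff_eq]; exact hvs.1, Finset.mem_univ _⟩)
  rw [Set.ncard_coe_finset, hcount] at key
  obtain ⟨t, ht, htP⟩ : {t ∈ ((s.image f : Finset (Set V)) : Set (Set V)) |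
      ∀ g ∈ P, g • t = t}.Nonempty := by
    by_contra h
    rw [Set.not_nonempty_iff_eq_empty.mp h, Set.ncard_empty] at key
    exact absurd key (by decide)
  obtain ⟨v, hvs, rfl⟩ := Finset.mem_image.mp (Finset.mem_coe.mp ht)
  exact ⟨v, (Finset.mem_erase.mp hvs).1, fun g hg => (hf _ _).mp ((hsm g v).symm.trans (htP g hg))⟩

/-- The elements acting as `1` or `-1`. -/
def signSubgroup (H V : Type*) [Group H] [AddCommGroup V] [DistribMulAction H V] : Subgroup H where
  carrier := {h | (∀ v : V, h • v = v) ∨ (∀ v : V, h • v = -v)}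
  one_mem' := Or.inl fun v => one_smul H v
  mul_mem' := by
    rintro a b (ha | ha) (hb | hb)
    · exact Or.inl fun v => by rw [mul_smul, hb, ha]
    · exact Or.inr fun v => by rw [mul_smul, hb, ha]
    · exact Or.inr fun v => by rw [mul_smul, hb, ha]
    · exact Or.inl fun v => by rw [mul_smul, hb, ha, neg_neg]
  inv_mem' := by
    rintro a (ha | ha)
    · exact Or.inl fun v => inv_smul_eq_iff.mpr (ha v).symm
    · exact Or.inr fun v => inv_smul_eq_iff.mpr (by rw [ha, neg_neg])

theorem mem_signSubgroup {h : H} :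
    h ∈ signSubgroup H V ↔ (∀ v : V, h • v = v) ∨ (∀ v : V, h • v = -v) := Iff.rfl

theorem hasSmallStabilizers27_of_normal_two [Finite V] [FaithfulSMul H V]
    (hirr : IsIrreducibleAction H V) (hcard : Nat.card V = 27) (h3 : ∀ x : V, x + x + x = 0)
    {P : Subgroup H} [hn : P.Normal] (hP : IsPGroup 2 P) (hPA : ¬ P ≤ signSubgroup H V) :
    HasSmallStabilizers27 H V := by
  obtain ⟨v₀, hv₀, hv₀P⟩ := exists_signed_vector_of_isPGroup_two hcard h3 hP
  have hsigned : ∀ h : H, ∀ g ∈ P, g • h • v₀ = h • v₀ ∨ g • h • v₀ = -(h • v₀) := by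
    intro h g hg
    have h1 := hv₀P (h⁻¹ * g * h) (by simpa using hn.conj_mem g hg h⁻¹)
    simp only [mul_smul, inv_smul_eq_iff, smul_neg] at h1
    exact h1
  have hsq : ∀ g ∈ P, ∀ x : V, g • g • x = x := by
    intro g hg
    let U : AddSubgroup V :=
      { carrier := {x | g • g • x = x}
        add_mem' := fun {a b} ha hb => by
          rw [Set.mem_ofPred_eq, smul_add, smul_add, show g • g • a = a from ha,
            show g • g • b = b from hb]
        zero_mem' := by rw [Set.mem_ofPred_eq, smul_zero, smul_zero]
        neg_mem' := fun {a} ha => by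
          rw [Set.mem_ofPred_eq, smul_neg, smul_neg, show g • g • a = a from ha] }
    have hU : U = ⊤ := hirr.eq_top_of_orbit_mem hv₀ fun h => by
      change g • g • h • v₀ = h • v₀
      rcases hsigned h g hg with e | e <;> simp [e]
    exact fun x => (hU ▸ AddSubgroup.mem_top x : x ∈ U)
  have hcomm : ∀ g ∈ P, ∀ k ∈ P, ∀ x : V, g • k • x = k • g • x := by
    intro g hg k hk
    let U : AddSubgroup V :=
      { carrier := {x | g • k • x = k • g • x}
        add_mem' := fun {a b} ha hb => by
          rw [Set.mem_ofPred_eq, smul_add, smul_add, smul_add, smul_add,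
            show g • k • a = k • g • a from ha, show g • k • b = k • g • b from hb]
        zero_mem' := by rw [Set.mem_ofPred_eq, smul_zero, smul_zero, smul_zero]
        neg_mem' := fun {a} ha => by
          rw [Set.mem_ofPred_eq, smul_neg, smul_neg, smul_neg, smul_neg,
            show g • k • a = k • g • a from ha] }
    have hU : U = ⊤ := hirr.eq_top_of_orbit_mem hv₀ fun h => by
      change g • k • h • v₀ = k • g • h • v₀
      rcases hsigned h g hg with e | e <;> rcases hsigned h k hk with e' | e' <;> simp [e, e']
    exact fun x => (hU ▸ AddSubgroup.mem_top x : x ∈ U)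
  obtain ⟨p, hp, hpA⟩ := SetLike.not_le_iff_exists.mp hPA
  rw [mem_signSubgroup, not_or] at hpA
  let U₁ : AddSubgroup V :=
    { carrier := {x | p • x = x}
      add_mem' := fun {a b} ha hb => by
        rw [Set.mem_ofPred_eq, smul_add, show p • a = a from ha, show p • b = b from hb]
      zero_mem' := smul_zero p
      neg_mem' := fun {a} ha => by rw [Set.mem_ofPred_eq, smul_neg, show p • a = a from ha] }
  let U₂ : AddSubgroup V :=
    { carrier := {x | p • x = -x}
      add_mem' := fun {a b} ha hb => by
        rw [Set.mem_ofPred_eq, smul_add, show p • a = -a from ha, show p • b = -b from hb, neg_add]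
      zero_mem' := by rw [Set.mem_ofPred_eq, smul_zero, neg_zero]
      neg_mem' := fun {a} ha => by rw [Set.mem_ofPred_eq, smul_neg, show p • a = -a from ha] }
  have hdisj : ∀ x ∈ U₁, x ∈ U₂ → x = 0 := fun x hx hx' =>
    eq_zero_of_eq_neg_of_add_add_eq_zero h3
      ((show p • x = x from hx).symm.trans (show p • x = -x from hx'))
  have hsup : U₁ ⊔ U₂ = ⊤ := by
    refine eq_top_iff.mpr fun x _ => AddSubgroup.mem_sup.mpr
      ⟨-(x + p • x), U₁.neg_mem ?_, -(x - p • x), U₂.neg_mem ?_, ?_⟩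
    · change p • (x + p • x) = x + p • x
      rw [smul_add, hsq p hp, add_comm]
    · change p • (x - p • x) = -(x - p • x)
      rw [smul_sub, hsq p hp, neg_sub]
    · have : x - (-(x + p • x) + -(x - p • x)) = x + x + x := by abel
      rw [h3, sub_eq_zero] at this
      exact this.symm
  have hprod : Nat.card U₁ * Nat.card U₂ = 27 := by
    rw [← AddSubgroup.card_sup_of_disjoint hdisj, hsup, AddSubgroup.card_top, hcard]
  have hone₁ : Nat.card U₁ ≠ 1 := fun h => by
    refine hpA.2 fun x => ?_
    have hU : U₂ = ⊤ := by
      rwa [AddSubgroup.card_eq_one.mp h, bot_sup_eq] at hsup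
    exact (hU ▸ AddSubgroup.mem_top x : x ∈ U₂)
  have hone₂ : Nat.card U₂ ≠ 1 := fun h => by
    refine hpA.1 fun x => ?_
    have hU : U₁ = ⊤ := by
      rwa [AddSubgroup.card_eq_one.mp h, sup_bot_eq] at hsup
    exact (hU ▸ AddSubgroup.mem_top x : x ∈ U₁)
  have key : ∀ L M : AddSubgroup V, Nat.card L = 3 → (∀ x ∈ L, x ∈ M → x = 0) →
      (∀ g ∈ P, ∀ x ∈ L, g • x ∈ L) → (∀ x, x ∈ L ∨ x ∈ M ↔ p • x = x ∨ p • x = -x) →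
      HasSmallStabilizers27 H V := by
    intro L M hL hLM hinv hmem
    obtain ⟨v, hvL, hv⟩ : ∃ v ∈ L, v ≠ 0 := L.bot_or_exists_ne_zero.resolve_left fun h => by
      rw [h, AddSubgroup.card_bot] at hL
      norm_num at hL
    have hle : lineAddSubgroup h3 v ≤ L := by
      rintro x (rfl | rfl | rfl)
      exacts [L.zero_mem, hvL, L.neg_mem hvL]
    have heq : lineAddSubgroup h3 v = L :=
      AddSubgroup.eq_of_le_of_card_ge hle (by rw [hL, card_lineAddSubgroup h3 hv])
    refine hasSmallStabilizers27_of_line hirr hcard h3 hv (fun h => hv (hLM v hvL h)) fun h => ?_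
    rw [heq, hmem]
    have hq := hinv (h⁻¹ * p * h) (by simpa using hn.conj_mem p hp h⁻¹) v hvL
    rw [← heq, mem_lineAddSubgroup, smul_eq_zero_iff_eq] at hq
    have := hq.resolve_left hv
    simpa only [mul_smul, inv_smul_eq_iff, smul_neg] using this
  have hdvd : Nat.card U₁ ∣ 3 ^ 3 := ⟨_, hprod.symm⟩
  obtain ⟨i, hi, hi'⟩ := (Nat.dvd_prime_pow Nat.prime_three).mp hdvd
  rw [hi'] at hprod hone₁
  interval_cases i
  · exact absurd rfl hone₁
  · refine key U₁ U₂ hi' hdisj (fun g hg x hx => ?_) fun x => Iff.rfl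
    change p • g • x = g • x
    rw [hcomm p hp g hg, show p • x = x from hx]
  · refine key U₂ U₁ (by omega) (fun x hx hx' => hdisj x hx' hx) (fun g hg x hx => ?_)
      fun x => or_comm
    change p • g • x = -(g • x)
    rw [hcomm p hp g hg, show p • x = -x from hx, smul_neg]
  · exact absurd (by omega) hone₂

theorem IsIrreducibleAction.hasSmallStabilizers27 [Finite H] [Group.IsSolvable H] [Finite V]
    [FaithfulSMul H V] (hirr : IsIrreducibleAction H V) (hcard : Nat.card V = 27)
    (h3 : ∀ x : V, x + x + x = 0) : HasSmallStabilizers27 H V := by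
  have hcomm : ∀ a ∈ signSubgroup H V, ∀ h : H, a * h = h * a := by
    intro a ha h
    refine FaithfulSMul.eq_of_smul_eq_smul (α := V) fun x => ?_
    rcases ha with ha | ha
    · rw [mul_smul, mul_smul, ha, ha]
    · rw [mul_smul, mul_smul, ha, ha, smul_neg]
  have : (signSubgroup H V).Normal := ⟨fun a ha h => by
    rwa [← hcomm a ha h, mul_inv_cancel_right]⟩
  have hcent : ¬ Subgroup.centralizer (signSubgroup H V : Set H) ≤ signSubgroup H V := by
    intro hle
    have : Nontrivial V := Finite.one_lt_card_iff_nontrivial.mp (by rw [hcard]; norm_num)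
    obtain ⟨v, hv⟩ := exists_ne (0 : V)
    have h9 := card_lineAddSubgroup h3 hv
    rw [hirr.eq_top_of_orbit_mem hv (U := lineAddSubgroup h3 v) fun h => ?_, AddSubgroup.card_top,
      hcard] at h9
    · norm_num at h9
    · rcases hle (Subgroup.mem_centralizer_iff.mpr fun a ha => hcomm a ha h) with e | e
      exacts [Or.inr (Or.inl (e v)), Or.inr (Or.inr (e v))]
  obtain ⟨r, P, hr, hn, hP, hPA, -, -⟩ := exists_normal_isPGroup_le_centralizer _ hcent
  have hbot : P ≠ ⊥ := fun h => hPA (h ▸ bot_le)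
  have : Fact r.Prime := ⟨hr⟩
  have h1 := card_modEq_one_of_fixed_eq_zero hP (fun v : V => hirr.eq_zero_of_fixed hbot) ⊤
    fun _ _ _ _ => AddSubgroup.mem_top _
  rw [AddSubgroup.card_top, hcard] at h1
  have hdvd : r ∣ 2 * 13 := (Nat.modEq_iff_dvd' (by norm_num)).mp h1.symm
  rcases (Nat.Prime.dvd_mul hr).mp hdvd with h | h
  · obtain rfl := (Nat.prime_dvd_prime_iff_eq hr (by norm_num)).mp h
    exact hasSmallStabilizers27_of_normal_two hirr hcard h3 hP hPA
  · obtain rfl := (Nat.prime_dvd_prime_iff_eq hr (by norm_num)).mp h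
    exact hasSmallStabilizers27_of_normal_thirteen hirr hcard hP hbot

end Degree27

section Affine

/-- `HasAffineDecomposition N H r`: the elementary abelian normal `r`-subgroup `N` and `H` generate
the group semidirectly, and `H` acts faithfully and irreducibly on `N` by conjugation. -/
structure HasAffineDecomposition {G : Type*} [Group G] (N H : Subgroup G) (r : ℕ) : Prop where
  normal : N.Normal
  comm : ∀ x ∈ N, ∀ y ∈ N, x * y = y * x
  pow_eq_one : ∀ x ∈ N, x ^ r = 1
  exists_mul : ∀ g : G, ∃ x ∈ N, ∃ h ∈ H, g = x * h
  eq_one_of_mem : ∀ x ∈ N, x ∈ H → x = 1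
  faithful : ∀ h ∈ H, (∀ x ∈ N, h * x * h⁻¹ = x) → h = 1
  irreducible : ∀ W ≤ N, (∀ h ∈ H, ∀ w ∈ W, h * w * h⁻¹ ∈ W) → W = ⊥ ∨ W = N

theorem isPretransitive_of_normal_of_ne_bot {G Ω : Type*} [Group G] [MulAction G Ω]
    [FaithfulSMul G Ω] [MulAction.IsPreprimitive G Ω] {N : Subgroup G} [N.Normal] (hN : N ≠ ⊥) :
    MulAction.IsPretransitive N Ω := by
  refine MulAction.IsQuasiPreprimitive.isPretransitive_of_normal (G := G) fun h => hN ?_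
  refine (Subgroup.eq_bot_iff_forall N).mpr fun g hg =>
    FaithfulSMul.eq_of_smul_eq_smul (α := Ω) fun x => ?_
  have hx : x ∈ MulAction.fixedPoints N Ω := h ▸ Set.mem_univ x
  rw [one_smul]
  exact hx ⟨g, hg⟩

/-- A finite solvable primitive permutation group is affine. -/
theorem exists_hasAffineDecomposition {G Ω : Type*} [Group G] [Finite G] [Group.IsSolvable G]
    [MulAction G Ω] [FaithfulSMul G Ω] [MulAction.IsPreprimitive G Ω] [Nontrivial Ω] (ω : Ω) :
    ∃ (r n : ℕ) (N : Subgroup G), r.Prime ∧ Nat.card N = r ^ n ∧ Nat.card N = Nat.card Ω ∧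
      HasAffineDecomposition N (MulAction.stabilizer G ω) r := by
  have hnt : ¬ Subgroup.centralizer ((⊥ : Subgroup G) : Set G) ≤ ⊥ := by
    intro h
    obtain ⟨ω', hω'⟩ := exists_ne ω
    obtain ⟨g, rfl⟩ := MulAction.exists_smul_eq G ω ω'
    have : g ∈ (⊥ : Subgroup G) := h (Subgroup.mem_centralizer_iff.mpr fun y hy => by
      rw [Subgroup.mem_bot.mp hy, one_mul, mul_one])
    exact hω' (by rw [Subgroup.mem_bot.mp this, one_smul])
  obtain ⟨r, P, hr, hn, hP, hbot, -, hPP⟩ := exists_normal_isPGroup_le_centralizer ⊥ hnt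
  have : Fact r.Prime := ⟨hr⟩
  have hcomm : ∀ x ∈ P, ∀ y ∈ P, x * y = y * x := fun x hx y hy =>
    commutatorElement_eq_one_iff_mul_comm.mp
      (Subgroup.mem_bot.mp (hPP (Subgroup.commutator_mem_commutator hx hy)))
  let N : Subgroup G :=
    { carrier := {x | x ∈ P ∧ x ^ r = 1}
      mul_mem' := fun {x y} hx hy => ⟨P.mul_mem hx.1 hy.1, by
        rw [(show Commute x y from hcomm x hx.1 y hy.1).mul_pow, hx.2, hy.2, one_mul]⟩
      one_mem' := ⟨P.one_mem, one_pow r⟩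
      inv_mem' := fun {x} hx => ⟨P.inv_mem hx.1, by rw [inv_pow, hx.2, inv_one]⟩ }
  have hNP : N ≤ P := fun x hx => hx.1
  have hNn : N.Normal := ⟨fun x hx g => ⟨hn.conj_mem x hx.1 g, by
    rw [conj_pow, hx.2, mul_one, mul_inv_cancel]⟩⟩
  have hNbot : N ≠ ⊥ := by
    obtain ⟨k, hk⟩ := IsPGroup.iff_card.mp hP
    have hk0 : k ≠ 0 := by
      rintro rfl
      exact hbot (Subgroup.card_eq_one.mp (by rw [hk, pow_zero])).le
    obtain ⟨y, hy⟩ := exists_prime_orderOf_dvd_card' (G := P) r (hk ▸ dvd_pow_self r hk0)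
    intro hN
    have hyN : (y : G) ∈ N := ⟨y.2, by
      rw [← Subgroup.coe_pow, ← hy, pow_orderOf_eq_one, Subgroup.coe_one]⟩
    rw [hN, Subgroup.mem_bot, OneMemClass.coe_eq_one] at hyN
    rw [hyN, orderOf_one] at hy
    exact hr.ne_one hy.symm
  have htrans : MulAction.IsPretransitive N Ω := isPretransitive_of_normal_of_ne_bot hNbot
  have hreg : ∀ x ∈ N, ∀ a : Ω, x • a = a → x = 1 := by
    intro x hx a hxa
    refine FaithfulSMul.eq_of_smul_eq_smul (α := Ω) fun b => ?_
    obtain ⟨⟨y, hy⟩, rfl⟩ := MulAction.exists_smul_eq N a b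
    change x • y • a = (1 : G) • y • a
    rw [one_smul, ← mul_smul, hcomm x hx.1 y hy.1, mul_smul, hxa]
  have hex : ∀ a : Ω, ∃ x ∈ N, x • ω = a := fun a => by
    obtain ⟨⟨y, hy⟩, h⟩ := MulAction.exists_smul_eq N ω a
    exact ⟨y, hy, h⟩
  obtain ⟨n, hn⟩ := IsPGroup.iff_card.mp (hP.to_le hNP)
  refine ⟨r, n, N, hr, hn, ?_, hNn, fun x hx y hy => hcomm x hx.1 y hy.1, fun x hx => hx.2,
    ?_, fun x hx hxω => hreg x hx ω hxω, ?_, ?_⟩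
  · refine Nat.card_congr (Equiv.ofBijective (fun x : N => (x : G) • ω) ⟨?_, ?_⟩)
    · intro x y hxy
      have h1 : ((y : G)⁻¹ * x) • ω = ω := by
        rw [mul_smul, inv_smul_eq_iff]; exact hxy
      have := hreg _ (N.mul_mem (N.inv_mem y.2) x.2) ω h1
      exact Subtype.ext (inv_mul_eq_one.mp this).symm
    · intro a
      obtain ⟨y, hy, h⟩ := hex a
      exact ⟨⟨y, hy⟩, h⟩
  · intro g
    obtain ⟨y, hy, h⟩ := hex (g • ω)
    refine ⟨y, hy, y⁻¹ * g, ?_, by rw [mul_inv_cancel_left]⟩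
    rw [MulAction.mem_stabilizer_iff, mul_smul, inv_smul_eq_iff, h]
  · intro h hh hc
    refine FaithfulSMul.eq_of_smul_eq_smul (α := Ω) fun a => ?_
    obtain ⟨y, hy, rfl⟩ := hex a
    rw [one_smul, ← mul_smul, mul_inv_eq_iff_eq_mul.mp (hc y hy), mul_smul,
      MulAction.mem_stabilizer_iff.mp hh]
  · intro W hWN hW
    refine or_iff_not_imp_left.mpr fun hWbot => le_antisymm hWN fun x hx => ?_
    have hWn : W.Normal := ⟨fun w hw g => by
      obtain ⟨y, hy, h⟩ := hex (g • ω)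
      have hh := hW (y⁻¹ * g) (by
        rw [MulAction.mem_stabilizer_iff, mul_smul, inv_smul_eq_iff, h]) w hw
      have : g * w * g⁻¹ = y * (y⁻¹ * g * w * (y⁻¹ * g)⁻¹) * y⁻¹ := by group
      rw [this, hcomm y hy.1 _ (hWN hh).1, mul_inv_cancel_right]
      exact hh⟩
    have := isPretransitive_of_normal_of_ne_bot (Ω := Ω) hWbot
    obtain ⟨⟨w, hw⟩, h⟩ := MulAction.exists_smul_eq W ω (x • ω)
    have h1 : (x⁻¹ * w) • ω = ω := by
      rw [mul_smul, inv_smul_eq_iff]; exact h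
    rw [inv_mul_eq_one.mp (hreg _ (N.mul_mem (N.inv_mem hx) (hWN hw)) ω h1)]
    exact hw

namespace HasAffineDecomposition

variable {G : Type*} [Group G] {N H : Subgroup G} {r : ℕ}

/-- The commutative group structure on `N`, written additively. -/
abbrev addCommGroup (hA : HasAffineDecomposition N H r) : AddCommGroup (Additive N) where
  add_comm a b := Subtype.ext (hA.comm a.toMul a.toMul.2 b.toMul b.toMul.2)

/-- The conjugation action of `H` on `N`, written additively. -/
abbrev distribMulAction (hA : HasAffineDecomposition N H r) :
    @DistribMulAction H (Additive N) _ hA.addCommGroup.toAddMonoid :=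
  let _ := hA.addCommGroup
  { smul := fun h x => Additive.ofMul ⟨h * x.toMul * (h : G)⁻¹, hA.normal.conj_mem _ x.toMul.2 h⟩
    one_smul := fun x => Subtype.ext (show (1 : G) * x.toMul * (1 : G)⁻¹ = x.toMul by group)
    mul_smul := fun h k x => Subtype.ext
      (show (h * k : G) * x.toMul * (h * k : G)⁻¹ = h * (k * x.toMul * (k : G)⁻¹) * (h : G)⁻¹ by
        group)
    smul_zero := fun h => Subtype.ext (show (h : G) * 1 * (h : G)⁻¹ = 1 by group)
    smul_add := fun h x y => Subtype.ext
      (show (h : G) * (x.toMul * y.toMul) * (h : G)⁻¹ =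
        h * x.toMul * (h : G)⁻¹ * (h * y.toMul * (h : G)⁻¹) by group) }

theorem faithfulSMul (hA : HasAffineDecomposition N H r) :
    @FaithfulSMul H (Additive N) hA.distribMulAction.toSMul := by
  let _ := hA.addCommGroup
  let _ := hA.distribMulAction
  refine ⟨fun {h k} hhk => ?_⟩
  have h1 := hA.faithful ((k : G)⁻¹ * h) (H.mul_mem (H.inv_mem k.2) h.2) fun x hx => by
    have h2 : (h * x * (h : G)⁻¹ : G) = k * x * (k : G)⁻¹ :=
      congrArg (fun y : Additive N => (y.toMul : G)) (hhk (Additive.ofMul ⟨x, hx⟩))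
    calc (k : G)⁻¹ * h * x * ((k : G)⁻¹ * h)⁻¹ = (k : G)⁻¹ * (h * x * (h : G)⁻¹) * k := by group
      _ = x := by rw [h2]; group
  exact Subtype.ext (inv_mul_eq_one.mp h1).symm

theorem isIrreducibleAction (hA : HasAffineDecomposition N H r) :
    @IsIrreducibleAction H (Additive N) _ hA.addCommGroup hA.distribMulAction := by
  let _ := hA.addCommGroup
  let _ := hA.distribMulAction
  intro W hW
  rcases hA.irreducible ((AddSubgroup.toSubgroup' W).map N.subtype) (Subgroup.map_subtype_le _)
    (by
      rintro h hh _ ⟨w, hw, rfl⟩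
      exact ⟨_, hW ⟨h, hh⟩ (Additive.ofMul w) hw, rfl⟩) with h | h
  · refine Or.inl ((AddSubgroup.eq_bot_iff_forall W).mpr fun w hw => Subtype.ext ?_)
    have : (w.toMul : G) ∈ (⊥ : Subgroup G) := h ▸ ⟨w.toMul, hw, rfl⟩
    exact Subgroup.mem_bot.mp this
  · refine Or.inr (eq_top_iff.mpr fun x _ => ?_)
    obtain ⟨w, hw, hwx⟩ : (x.toMul : G) ∈ (AddSubgroup.toSubgroup' W).map N.subtype :=
      h.ge x.toMul.2
    have : Additive.ofMul w = x := Subtype.ext hwx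
    exact this ▸ hw

theorem exists_of_card_eq_sixteen [Finite G] [Group.IsSolvable G]
    (hA : HasAffineDecomposition N H 2) (hcard : Nat.card N = 16) :
    ∃ v ∈ N, v ≠ 1 ∧ ∃ W ≤ N, Nat.card W = 4 ∧ (∀ h ∈ H, h * v * h⁻¹ = v → h ^ 4 = 1) ∧
      (∀ h ∈ H, (∀ w ∈ W, h * w * h⁻¹ ∈ W) → h ^ 4 = 1) := by
  let _ := hA.addCommGroup
  let _ := hA.distribMulAction
  have := hA.faithfulSMul
  obtain ⟨v, hv, W, hW, h1, h2⟩ := hA.isIrreducibleAction.hasSmallStabilizers16 hcard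
    fun x => Subtype.ext (show (x.toMul * x.toMul : G) = 1 by
      rw [← pow_two, hA.pow_eq_one _ x.toMul.2])
  refine ⟨v.toMul, v.toMul.2, fun h => hv (Subtype.ext h),
    (AddSubgroup.toSubgroup' W).map N.subtype, Subgroup.map_subtype_le _, ?_, ?_, ?_⟩
  · rw [Subgroup.card_map_of_injective N.subtype_injective]
    exact hW
  · intro h hh hhv
    exact congrArg Subtype.val (h1 ⟨h, hh⟩ (Subtype.ext hhv))
  · intro h hh hhW
    refine congrArg Subtype.val (h2 ⟨h, hh⟩ fun w hw => ?_)
    obtain ⟨y, hy, hyw⟩ := hhW _ ⟨w.toMul, hw, rfl⟩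
    have : (⟨h, hh⟩ : H) • w = Additive.ofMul y := Subtype.ext hyw.symm
    rw [this]
    exact hy

theorem exists_of_card_eq_twentySeven [Finite G] [Group.IsSolvable G]
    (hA : HasAffineDecomposition N H 3) (hcard : Nat.card N = 27) :
    ∃ v ∈ N, v ≠ 1 ∧ (∀ h ∈ H, h * v * h⁻¹ = v → ∃ k, h ^ (2 ^ k * 3) = 1) ∧
      (∀ h ∈ H, ∀ k ∈ H, h * v * h⁻¹ = v → k * v * k⁻¹ = v → h ^ 3 = 1 → k ^ 3 = 1 →
        Commute h k) := by
  let _ := hA.addCommGroup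
  let _ := hA.distribMulAction
  have := hA.faithfulSMul
  obtain ⟨v, hv, h1, h2⟩ := hA.isIrreducibleAction.hasSmallStabilizers27 hcard
    fun x => Subtype.ext (show (x.toMul * x.toMul * x.toMul : G) = 1 by
      rw [← pow_two, ← pow_succ, hA.pow_eq_one _ x.toMul.2])
  refine ⟨v.toMul, v.toMul.2, fun h => hv (Subtype.ext h), ?_, ?_⟩
  · intro h hh hhv
    obtain ⟨k, hk⟩ := h1 ⟨h, hh⟩ (Subtype.ext hhv)
    exact ⟨k, congrArg Subtype.val hk⟩
  · intro h hh k hk hhv hkv hh3 hk3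
    exact congrArg Subtype.val (h2 ⟨h, hh⟩ ⟨k, hk⟩ (Subtype.ext hhv) (Subtype.ext hkv)
      (Subtype.ext hh3) (Subtype.ext hk3)).eq

end HasAffineDecomposition

end Affine

section Transfer

open MulAction

variable {G Ω : Type*} [Group G] [MulAction G Ω]

theorem requiredStructure_of_pow_eight_eq_one {S : Type*} [Group S] (h : ∀ x : S, x ^ 8 = 1) :
    RequiredStructure S := by
  have hone : ∀ x : S, x ^ 3 = 1 → x = 1 := fun x hx => by
    have : x ^ 9 = 1 := by rw [show 9 = 3 * 3 from rfl, pow_mul, hx, one_pow]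
    rwa [pow_succ, h, one_mul] at this
  refine requiredStructure_of_pow_eq_one (fun x y hx hy => ?_) fun x => ⟨3, ?_⟩
  · rw [hone x hx, hone y hy]
  · rw [pow_mul, show 2 ^ 3 = 8 from rfl, h, one_pow]

theorem eq_one_or_self_or_inv_of_mem_zpowers {v x : G} (hv : v ^ 3 = 1)
    (hx : x ∈ Subgroup.zpowers v) : x = 1 ∨ x = v ∨ x = v⁻¹ := by
  obtain ⟨i, rfl⟩ := Subgroup.mem_zpowers_iff.mp hx
  have h1 : v ^ i = v ^ (i % 3) := by
    nth_rewrite 1 [← Int.mul_ediv_add_emod i 3]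
    rw [zpow_add, zpow_mul, show v ^ (3 : ℤ) = 1 from mod_cast hv, one_zpow, one_mul]
  have h2 : v ^ (2 : ℤ) = v⁻¹ := by
    rw [eq_inv_iff_mul_eq_one, ← zpow_add_one]
    exact mod_cast hv
  have : i % 3 = 0 ∨ i % 3 = 1 ∨ i % 3 = 2 := by omega
  rcases this with h | h | h <;> simp [h1, h, h2]

/-- The square of an element preserving `{ω, v • ω}` fixes `ω` and `v • ω`. -/
theorem sq_mem_stabilizer_of_smul_pair {v g : G} {ω : Ω}
    (hg : g • ({ω, v • ω} : Set Ω) = {ω, v • ω}) :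
    g ^ 2 • ω = ω ∧ g ^ 2 • v • ω = v • ω := by
  rw [Set.smul_set_insert, Set.smul_set_singleton, Set.pair_eq_pair_iff] at hg
  simp only [pow_two, mul_smul]
  rcases hg with ⟨h1, h2⟩ | ⟨h1, h2⟩ <;> simp only [h1, h2, and_self]

variable {N : Subgroup G} {r : ℕ} {ω : Ω}

namespace HasAffineDecomposition

theorem injOn_smul (hA : HasAffineDecomposition N (stabilizer G ω) r) {x y : G} (hx : x ∈ N)
    (hy : y ∈ N) (h : x • ω = y • ω) : x = y := by
  refine (inv_mul_eq_one.mp (hA.eq_one_of_mem (y⁻¹ * x) (N.mul_mem (N.inv_mem hy) hx) ?_)).symm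
  rw [mem_stabilizer_iff, mul_smul, inv_smul_eq_iff, h]

theorem conj_eq_of_fixed (hA : HasAffineDecomposition N (stabilizer G ω) r) {v h : G} (hv : v ∈ N)
    (hh : h • ω = ω) (hhv : h • v • ω = v • ω) : h * v * h⁻¹ = v := by
  refine hA.injOn_smul (hA.normal.conj_mem v hv h) hv ?_
  rw [mul_smul, mul_smul, inv_smul_eq_iff.mpr hh.symm, hhv]

theorem ncard_smul_set (hA : HasAffineDecomposition N (stabilizer G ω) r) {W : Subgroup G}
    (hW : W ≤ N) : ((fun w : G => w • ω) '' (W : Set G)).ncard = Nat.card W := by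
  rw [Set.InjOn.ncard_image fun x hx y hy h => hA.injOn_smul (hW hx) (hW hy) h,
    ← Nat.card_coe_set_eq]
  rfl

/-- An element preserving `W • ω` is the product of an element of `W` and an element of the
point stabilizer normalizing `W`. -/
theorem exists_mul_of_smul_image_eq (hA : HasAffineDecomposition N (stabilizer G ω) r)
    {W : Subgroup G} (hW : W ≤ N) {g : G}
    (hg : g • ((fun w : G => w • ω) '' (W : Set G)) = (fun w : G => w • ω) '' (W : Set G)) :
    ∃ w ∈ W, ∃ h ∈ stabilizer G ω, g = w * h ∧ ∀ y ∈ W, h * y * h⁻¹ ∈ W := by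
  have hmem : ∀ y ∈ W, ∃ z ∈ W, z • ω = g • y • ω := fun y hy => by
    have : g • y • ω ∈ g • ((fun w : G => w • ω) '' (W : Set G)) :=
      Set.smul_mem_smul_set ⟨y, hy, rfl⟩
    rwa [hg] at this
  obtain ⟨w, hw, h1⟩ := hmem 1 W.one_mem
  have hh : (w⁻¹ * g) • ω = ω := by
    rw [mul_smul, inv_smul_eq_iff, h1, one_smul]
  refine ⟨w, hw, w⁻¹ * g, hh, by rw [mul_inv_cancel_left], fun y hy => ?_⟩
  obtain ⟨z, hz, h2⟩ := hmem y hy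
  have : w⁻¹ * g * y * (w⁻¹ * g)⁻¹ = w⁻¹ * z := by
    refine hA.injOn_smul (hA.normal.conj_mem y (hW hy) _)
      (hW (W.mul_mem (W.inv_mem hw) hz)) ?_
    rw [mul_smul, inv_smul_eq_iff.mpr hh.symm, mul_smul, mul_smul, mul_smul, h2]
  rw [this]
  exact W.mul_mem (W.inv_mem hw) hz

theorem exists_sets_of_card_eq_sixteen [Finite G] [Group.IsSolvable G]
    (hA : HasAffineDecomposition N (stabilizer G ω) 2) (hcard : Nat.card N = 16) :
    ∃ Δ₁ Δ₂ : Set Ω, Δ₁.ncard = 2 ∧ Δ₂.ncard = 4 ∧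
      RequiredStructure (stabilizer G Δ₁) ∧ RequiredStructure (stabilizer G Δ₂) := by
  obtain ⟨v, hvN, hv, W, hWN, hW, h1, h2⟩ := hA.exists_of_card_eq_sixteen hcard
  refine ⟨{ω, v • ω}, _, Set.ncard_pair fun h => hv ?_, (hA.ncard_smul_set hWN).trans hW,
    requiredStructure_of_pow_eight_eq_one ?_, requiredStructure_of_pow_eight_eq_one ?_⟩
  · exact hA.injOn_smul hvN N.one_mem (by rw [one_smul, ← h])
  · rintro ⟨g, hg⟩
    obtain ⟨hω, hvω⟩ := sq_mem_stabilizer_of_smul_pair hg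
    refine Subtype.ext ?_
    change g ^ (2 * 4) = 1
    rw [pow_mul]
    exact h1 _ hω (hA.conj_eq_of_fixed hvN hω hvω)
  · rintro ⟨g, hg⟩
    obtain ⟨w, hw, h, hh, rfl, hhW⟩ := hA.exists_mul_of_smul_image_eq hWN hg
    refine Subtype.ext ?_
    change (w * h) ^ (4 * 2) = 1
    have hpow : ∀ n : ℕ, ∃ y ∈ W, (w * h) ^ n = y * h ^ n := by
      intro n
      induction n with
      | zero => exact ⟨1, W.one_mem, by simp⟩
      | succ n ih =>
        obtain ⟨y, hy, e⟩ := ih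
        refine ⟨w * (h * y * h⁻¹), W.mul_mem hw (hhW y hy), ?_⟩
        rw [pow_succ', e, pow_succ']
        group
    obtain ⟨y, hy, e⟩ := hpow 4
    rw [pow_mul, e, h2 h hh hhW, mul_one]
    exact hA.pow_eq_one y (hWN hy)

theorem exists_sets_of_card_eq_twentySeven [Finite G] [Group.IsSolvable G]
    (hA : HasAffineDecomposition N (stabilizer G ω) 3) (hcard : Nat.card N = 27) :
    ∃ Δ₁ Δ₂ : Set Ω, Δ₁.ncard = 2 ∧ Δ₂.ncard = 3 ∧
      RequiredStructure (stabilizer G Δ₁) ∧ RequiredStructure (stabilizer G Δ₂) := by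
  obtain ⟨v, hvN, hv, hpow, hcomm⟩ := hA.exists_of_card_eq_twentySeven hcard
  have hv3 : v ^ 3 = 1 := hA.pow_eq_one v hvN
  have hZN : Subgroup.zpowers v ≤ N := Subgroup.zpowers_le.mpr hvN
  have hZ : Nat.card (Subgroup.zpowers v) = 3 := by
    rw [Nat.card_zpowers]
    exact orderOf_eq_prime hv3 hv
  have hcube : ∀ g : G, g ^ 3 = 1 → (g ^ 2) ^ 2 = g := fun g hg => by
    rw [← pow_mul, show 2 * 2 = 3 + 1 from rfl, pow_succ, hg, one_mul]
  have hzpow : ∀ i : ℤ, (v ^ i) ^ 3 = 1 := fun i =>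
    hA.pow_eq_one _ (hZN (Subgroup.zpow_mem_zpowers v i))
  have hsq : ∀ g ∈ stabilizer G ((fun w : G => w • ω) '' (Subgroup.zpowers v : Set G)),
      ∃ i : ℤ, ∃ a, a • ω = ω ∧ Commute a v ∧ g ^ 2 = v ^ i * a := by
    intro g hg
    obtain ⟨w, hw, h, hh, rfl, hhZ⟩ := hA.exists_mul_of_smul_image_eq hZN hg
    have hhv : h ^ 2 * v * (h ^ 2)⁻¹ = v := by
      have h2 : h ^ 2 * v * (h ^ 2)⁻¹ = h * (h * v * h⁻¹) * h⁻¹ := by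
        rw [pow_two]
        group
      rcases eq_one_or_self_or_inv_of_mem_zpowers hv3 (hhZ v (Subgroup.mem_zpowers v)) with
        e | e | e
      · exact absurd (conj_eq_one_iff.mp e) hv
      · rw [h2, e, e]
      · rw [h2, e, ← conj_inv, e, inv_inv]
    obtain ⟨i, hi⟩ := Subgroup.mem_zpowers_iff.mp (Subgroup.mul_mem _ hw (hhZ w hw))
    refine ⟨i, h ^ 2, (stabilizer G ω).pow_mem hh 2, mul_inv_eq_iff_eq_mul.mp hhv, ?_⟩
    rw [hi, pow_two, pow_two]
    group
  refine ⟨{ω, v • ω}, _, Set.ncard_pair fun h => hv ?_, (hA.ncard_smul_set hZN).trans hZ,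
    requiredStructure_of_pow_eq_one ?_ ?_, requiredStructure_of_pow_eq_one ?_ ?_⟩
  · exact hA.injOn_smul hvN N.one_mem (by rw [one_smul, ← h])
  · have key : ∀ g : stabilizer G ({ω, v • ω} : Set Ω), g ^ 3 = 1 →
        (g : G) • ω = ω ∧ (g : G) * v * (g : G)⁻¹ = v := by
      rintro ⟨g, hg⟩ hg3
      have hg4 := hcube g (congrArg Subtype.val hg3)
      obtain ⟨hω, hvω⟩ := sq_mem_stabilizer_of_smul_pair hg
      have hω' : g • ω = ω := by rw [← hg4, pow_two, mul_smul, hω, hω]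
      have hvω' : g • v • ω = v • ω := by rw [← hg4, pow_two, mul_smul, hvω, hvω]
      exact ⟨hω', hA.conj_eq_of_fixed hvN hω' hvω'⟩
    intro x y hx hy
    exact Subtype.ext (hcomm x (key x hx).1 y (key y hy).1 (key x hx).2 (key y hy).2
      (congrArg Subtype.val hx) (congrArg Subtype.val hy)).eq
  · rintro ⟨g, hg⟩
    obtain ⟨hω, hvω⟩ := sq_mem_stabilizer_of_smul_pair hg
    obtain ⟨k, hk⟩ := hpow _ hω (hA.conj_eq_of_fixed hvN hω hvω)
    refine ⟨k + 1, Subtype.ext ?_⟩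
    change g ^ (2 ^ (k + 1) * 3) = 1
    rw [show 2 ^ (k + 1) * 3 = 2 * (2 ^ k * 3) by ring, pow_mul, hk]
  · have key : ∀ g : stabilizer G ((fun w : G => w • ω) '' (Subgroup.zpowers v : Set G)),
        g ^ 3 = 1 → ∃ i : ℤ, ∃ a, a • ω = ω ∧ Commute a v ∧ a ^ 3 = 1 ∧ (g : G) = v ^ i * a := by
      rintro ⟨g, hg⟩ hg3
      replace hg3 : g ^ 3 = 1 := congrArg Subtype.val hg3
      obtain ⟨i, a, haω, hav, e⟩ := hsq g hg
      have hg2 : g = v ^ (i * 2) * a ^ 2 := by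
        rw [← hcube g hg3, e, (hav.zpow_right i).symm.mul_pow, zpow_mul, zpow_ofNat]
      refine ⟨i * 2, a ^ 2, (stabilizer G ω).pow_mem haω 2, hav.pow_left 2, ?_, hg2⟩
      rwa [hg2, ((hav.pow_left 2).zpow_right _).symm.mul_pow, hzpow, one_mul] at hg3
    intro x y hx hy
    obtain ⟨i, a, haω, hav, ha, hxe⟩ := key x hx
    obtain ⟨j, b, hbω, hbv, hb, hye⟩ := key y hy
    refine Subtype.ext ?_
    change (x * y : G) = y * x
    rw [hxe, hye]
    have hab := hcomm a haω b hbω (mul_inv_eq_iff_eq_mul.mpr hav) (mul_inv_eq_iff_eq_mul.mpr hbv)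
      ha hb
    exact (((Commute.refl v).zpow_zpow i j).mul_right (hbv.zpow_right i).symm).mul_left
      ((hav.zpow_right j).mul_right hab)
  · rintro ⟨g, hg⟩
    obtain ⟨i, a, haω, hav, e⟩ := hsq g hg
    obtain ⟨k, hk⟩ := hpow a haω (mul_inv_eq_iff_eq_mul.mpr hav)
    refine ⟨k + 1, Subtype.ext ?_⟩
    change g ^ (2 ^ (k + 1) * 3) = 1
    rw [show 2 ^ (k + 1) * 3 = 2 * (2 ^ k * 3) by ring, pow_mul, e,
      (hav.zpow_right i).symm.mul_pow, hk, mul_one, mul_comm, pow_mul, hzpow, one_pow]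

end HasAffineDecomposition

end Transfer

/-- Lemma 2.3: a primitive solvable permutation group of degree 16 or 27 is nice. -/
theorem stmt_11 {Ω : Type*} [Fintype Ω] (G : Subgroup (Equiv.Perm Ω))
    (hsolv : IsSolvable G) (hprim : IsPrimitivePermGroup Ω G)
    (hcard : Fintype.card Ω = 16 ∨ Fintype.card Ω = 27) :
    IsNice Ω G := by
  have : MulAction.IsPreprimitive G Ω :=
    { hprim.1 with isTrivialBlock_of_isBlock := fun {B} => hprim.2 B }
  have : Nontrivial Ω := Fintype.one_lt_card_iff_nontrivial.mp (by omega)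
  have : Group.IsSolvable G := hsolv
  obtain ⟨ω⟩ : Nonempty Ω := inferInstance
  obtain ⟨r, n, N, hr, hn, hN, hA⟩ := exists_hasAffineDecomposition (G := G) ω
  have hr' : ∀ {p k : ℕ}, p.Prime → Nat.card N = p ^ k → k ≠ 0 → p = r := fun hp h hk =>
    (Nat.prime_dvd_prime_iff_eq hp hr).mp (hp.dvd_of_dvd_pow (hn ▸ h ▸ dvd_pow_self _ hk))
  rw [Nat.card_eq_fintype_card (α := Ω)] at hN
  rcases hcard with h | h
  · obtain rfl := hr' Nat.prime_two (k := 4) (by omega) (by norm_num)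
    obtain ⟨Δ₁, Δ₂, h1, h2, hΔ⟩ := hA.exists_sets_of_card_eq_sixteen (hN.trans h)
    exact ⟨Δ₁, Δ₂, by omega, by omega, hΔ⟩
  · obtain rfl := hr' Nat.prime_three (k := 3) (by omega) (by norm_num)
    obtain ⟨Δ₁, Δ₂, h1, h2, hΔ⟩ := hA.exists_sets_of_card_eq_twentySeven (hN.trans h)
    exact ⟨Δ₁, Δ₂, by omega, by omega, hΔ⟩
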